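/- Let n ≥ 1 and let X_1, …, X_n be i.i.d. integer-valued random variables with E[X_1] = μ, Var(X_1) = σ^2 > 0, E[(X_1 − μ)^3] = σ^3·γ and E[X_1^4] < ∞. Suppose the support of X_1 is {s_0, s_1, s_2, …} with the greatest common divisor of {|s_i − s_0| : i ≥ 1} equal to 1. Let W = (1/(σ√n))·Σ_{i=1}^n (X_i − μ) and Z ~ N(0,1). Then there exists a constant C, depending only on the distribution of X_1 and not on n, such that for every measurable h : ℝ → ℝ with ‖h‖_∞ ≤ 1 and with the property that for every point z in the support of W, h is constant on the interval (z − 1/(2σ√n), z + 1/(2σ√n)), one has |E[h(W)] − E[h(Z)] − (γ/(6√n))·E[(Z^3 − 3Z)·h(Z)]| ≤ C/n. -/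

import Mathlib

open MeasureTheory ProbabilityTheory
open scoped ENNReal

namespace Edgeworth

open Complex (I)

lemma norm_cexp_sub_taylor_le (x : ℝ) {m : ℕ} (hm : 0 < m) :
    ‖Complex.exp (x * I) - ∑ j ∈ Finset.range m, (x * I) ^ j / (j.factorial : ℂ)‖
      ≤ (m + 1) * |x| ^ m := by
  have hx : ‖(x : ℂ) * I‖ = |x| := by simp
  have hm1 : (1 : ℝ) ≤ m := by exact_mod_cast hm
  rcases le_or_gt |x| 1 with h | h
  · refine (Complex.exp_bound (hx.trans_le h) hm).trans ?_
    rw [hx, mul_comm]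
    gcongr
    have hf : (1 : ℝ) ≤ m.factorial := by exact_mod_cast Nat.one_le_iff_ne_zero.2 m.factorial_ne_zero
    rw [← div_eq_mul_inv, div_le_iff₀ (by positivity)]
    push_cast
    have : 1 * 1 ≤ (m.factorial : ℝ) * m := by gcongr
    exact le_mul_of_one_le_right (by positivity) (by linarith)
  · have h1 : ∀ j ∈ Finset.range m, ‖((x : ℂ) * I) ^ j / (j.factorial : ℂ)‖ ≤ |x| ^ m := by
      intro j hj
      have hf : (1 : ℝ) ≤ j.factorial := by
        exact_mod_cast Nat.one_le_iff_ne_zero.2 j.factorial_ne_zero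
      rw [norm_div, norm_pow, hx, Complex.norm_natCast]
      exact (div_le_self (by positivity) hf).trans
        (pow_le_pow_right₀ h.le (Finset.mem_range.1 hj).le)
    refine (norm_sub_le _ _).trans ?_
    have h2 := (norm_sum_le _ _).trans (Finset.sum_le_sum h1)
    rw [Complex.norm_exp_ofReal_mul_I]
    simp only [Finset.sum_const, Finset.card_range, nsmul_eq_mul] at h2
    have h3 : 1 ≤ |x| ^ m := one_le_pow₀ h.le
    linarith

/-- The `j`-th derivative, up to a factor `I ^ j`, of the characteristic function of `Y`. -/
noncomputable def momentChar {α : Type*} [MeasurableSpace α] (μ : Measure α) (Y : α → ℝ) (j : ℕ)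
    (s : ℝ) : ℂ :=
  ∫ k, (Y k : ℂ) ^ j * Complex.exp ((s * Y k : ℝ) * I) ∂μ

section momentChar

variable {α : Type*} [MeasurableSpace α] {μ : Measure α} [IsProbabilityMeasure μ] {Y : α → ℝ}

lemma integrable_pow_of_pow_four (hY : Measurable Y) (h4 : Integrable (fun k => Y k ^ 4) μ)
    {j : ℕ} (hj : j ≤ 4) : Integrable (fun k => Y k ^ j) μ := by
  refine ((integrable_const (1 : ℝ)).add h4).mono' (hY.pow_const j).aestronglyMeasurable
    (.of_forall fun k => ?_)
  have h40 : Y k ^ 4 = |Y k| ^ 4 := by rw [pow_abs, abs_of_nonneg (by positivity)]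
  simp only [Pi.add_apply, Real.norm_eq_abs, abs_pow, h40]
  rcases le_or_gt |Y k| 1 with h | h
  · have := pow_le_one₀ (n := j) (abs_nonneg (Y k)) h
    have : 0 ≤ |Y k| ^ 4 := by positivity
    linarith
  · have := pow_le_pow_right₀ h.le hj
    linarith

lemma integrable_momentChar (hY : Measurable Y) (h4 : Integrable (fun k => Y k ^ 4) μ)
    {j : ℕ} (hj : j ≤ 4) (s : ℝ) :
    Integrable (fun k => (Y k : ℂ) ^ j * Complex.exp ((s * Y k : ℝ) * I)) μ := by
  refine (integrable_pow_of_pow_four hY h4 hj).norm.mono' (by fun_prop) (.of_forall fun k => ?_)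
  rw [norm_mul, Complex.norm_exp_ofReal_mul_I]
  simp

lemma norm_momentChar_sub_le (hY : Measurable Y) (h4 : Integrable (fun k => Y k ^ 4) μ)
    {j m : ℕ} (hm : 0 < m) (hjm : j + m = 4) (s : ℝ) :
    ‖momentChar μ Y j s -
        ∑ l ∈ Finset.range m, (s * I) ^ l / (l.factorial : ℂ) * ((∫ k, Y k ^ (j + l) ∂μ : ℝ) : ℂ)‖
      ≤ (m + 1) * |s| ^ m * ∫ k, Y k ^ 4 ∂μ := by
  have hint : ∀ l ∈ Finset.range m, Integrable (fun k =>
      (s * I) ^ l / (l.factorial : ℂ) * ((Y k ^ (j + l) : ℝ) : ℂ)) μ := fun l hl =>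
    ((integrable_pow_of_pow_four hY h4 (by have := Finset.mem_range.1 hl; omega)).ofReal).const_mul _
  have hsum : ∑ l ∈ Finset.range m, (s * I) ^ l / (l.factorial : ℂ) *
      ((∫ k, Y k ^ (j + l) ∂μ : ℝ) : ℂ) = ∫ k, ∑ l ∈ Finset.range m,
        (s * I) ^ l / (l.factorial : ℂ) * ((Y k ^ (j + l) : ℝ) : ℂ) ∂μ := by
    rw [integral_finsetSum _ hint]
    refine Finset.sum_congr rfl fun l _ => ?_
    rw [integral_const_mul, integral_complex_ofReal]
  rw [hsum, momentChar, ← integral_sub (integrable_momentChar hY h4 (by omega) s)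
    (integrable_finsetSum _ hint), ← integral_const_mul]
  refine norm_integral_le_of_norm_le (h4.const_mul _) (.of_forall fun k => ?_)
  have h := norm_cexp_sub_taylor_le (s * Y k) hm
  have h1 : (Y k : ℂ) ^ j * Complex.exp ((s * Y k : ℝ) * I) - ∑ l ∈ Finset.range m,
        (s * I) ^ l / (l.factorial : ℂ) * ((Y k ^ (j + l) : ℝ) : ℂ) =
      (Y k : ℂ) ^ j * (Complex.exp ((s * Y k : ℝ) * I) -
        ∑ l ∈ Finset.range m, ((s * Y k : ℝ) * I) ^ l / (l.factorial : ℂ)) := by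
    rw [mul_sub, Finset.mul_sum]
    congr 1
    refine Finset.sum_congr rfl fun l _ => ?_
    push_cast
    ring
  rw [h1, norm_mul, norm_pow, Complex.norm_real, Real.norm_eq_abs]
  calc |Y k| ^ j * _ ≤ |Y k| ^ j * ((m + 1) * |s * Y k| ^ m) := by gcongr
    _ = (m + 1) * |s| ^ m * |Y k| ^ (j + m) := by rw [abs_mul, mul_pow, pow_add]; ring
    _ = (m + 1) * |s| ^ m * Y k ^ 4 := by
      rw [hjm, pow_abs (Y k), abs_of_nonneg (show 0 ≤ Y k ^ 4 by positivity)]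

end momentChar

lemma norm_pow_sub_one_sub_le (r : ℂ) (m : ℕ) :
    ‖r ^ m - 1 - m * (r - 1)‖ ≤ m ^ 2 * ‖r - 1‖ ^ 2 * Real.exp (m * ‖r - 1‖) := by
  set d := ‖r - 1‖ with hd
  have hd0 : 0 ≤ d := norm_nonneg _
  have hr : ‖r‖ ≤ Real.exp d := by
    have : ‖r‖ ≤ ‖r - 1‖ + ‖(1 : ℂ)‖ := by simpa using norm_add_le (r - 1) 1
    rw [norm_one] at this
    linarith [Real.add_one_le_exp d]
  induction m with
  | zero => simp
  | succ m ih =>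
    have h1 : r ^ (m + 1) - 1 - ((m + 1 : ℕ) : ℂ) * (r - 1) =
        r * (r ^ m - 1 - m * (r - 1)) + m * (r - 1) ^ 2 := by push_cast; ring
    have h2 : Real.exp ((m + 1 : ℕ) * d) = Real.exp d * Real.exp (m * d) := by
      rw [← Real.exp_add]; push_cast; ring_nf
    have h3 : 1 ≤ Real.exp d * Real.exp (m * d) := by
      rw [← h2]; exact Real.one_le_exp (by positivity)
    rw [h1, h2]
    calc ‖r * (r ^ m - 1 - m * (r - 1)) + m * (r - 1) ^ 2‖
        ≤ ‖r‖ * ‖r ^ m - 1 - m * (r - 1)‖ + m * d ^ 2 := by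
          refine (norm_add_le _ _).trans ?_
          rw [norm_mul, norm_mul, norm_pow, Complex.norm_natCast]
      _ ≤ Real.exp d * (m ^ 2 * d ^ 2 * Real.exp (m * d)) +
          m * d ^ 2 * (Real.exp d * Real.exp (m * d)) := by
          refine add_le_add (by gcongr) (le_mul_of_one_le_right (by positivity) h3)
      _ = (m ^ 2 + m) * d ^ 2 * (Real.exp d * Real.exp (m * d)) := by ring
      _ ≤ _ := by
          gcongr
          push_cast
          nlinarith [(Nat.cast_nonneg m : (0 : ℝ) ≤ m)]

lemma error_polynomial_le {K q N : ℝ} (hK : 1 ≤ K) (hq0 : 0 ≤ q) (hN : 0 < N) :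
    49 * K ^ 2 * q ^ 3 / N + (6 * K * q ^ 2 / N + 2 * K * q / N + 2 * q / N * (1 + K * q)) ≤
      60 * K ^ 2 / N * (1 + q) ^ 3 := by
  have hKK : K ≤ K ^ 2 := by nlinarith
  have hK1 : 1 ≤ K ^ 2 := by nlinarith
  have e1 : 49 * K ^ 2 * q ^ 3 / N +
    (6 * K * q ^ 2 / N + 2 * K * q / N + 2 * q / N * (1 + K * q)) =
    (49 * K ^ 2 * q ^ 3 + 6 * K * q ^ 2 + 2 * K * q + 2 * q * (1 + K * q)) / N := by ring
  rw [e1, div_mul_eq_mul_div]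
  gcongr
  have : 6 * K * q ^ 2 ≤ 6 * K ^ 2 * q ^ 2 := by gcongr
  have : 2 * K * q ≤ 2 * K ^ 2 * q := by gcongr
  have : 2 * q * (1 + K * q) ≤ 2 * q * (K ^ 2 + K ^ 2 * q) := by gcongr
  have : 0 ≤ K ^ 2 * q := by positivity
  have : 0 ≤ K ^ 2 * q ^ 2 := by positivity
  have : 0 ≤ K ^ 2 * q ^ 3 := by positivity
  nlinarith


section core

variable {K γ s : ℝ} {z0 z1 z2 : ℂ}

/-- The Fourier transform of `(1 + x ^ 2)` times the Edgeworth density, at `s * √n`. -/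
noncomputable def edgeworthTransform (γ : ℝ) (n : ℕ) (s : ℝ) : ℂ :=
  Real.exp (-(n * s ^ 2) / 2) *
    (2 - n * s ^ 2 - I * γ / 6 * (-(n ^ 2 * s ^ 5) + 8 * (n * s ^ 3) - 6 * s))

set_option maxHeartbeats 1000000 in
/-- Third order expansion of a power of a characteristic function near the origin. -/
lemma norm_pow_sub_gaussian_le (hK : 1 ≤ K) (hγ : |γ| ≤ K) (hs : |s| ≤ 1 / (28 * K))
    (h0 : ‖z0 - (1 - s ^ 2 / 2 - I * γ * s ^ 3 / 6)‖ ≤ K * s ^ 4) {n : ℕ} (hn : 2 ≤ n) :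
    ‖z0 ^ (n - 2)‖ ≤ 2 * Real.exp (-(n * s ^ 2) / 4) ∧
    ‖z0 ^ (n - 2) - Real.exp (-(n * s ^ 2) / 2) * (1 - n * (I * γ * s ^ 3 / 6))‖ ≤
      120 * K ^ 2 / n * (1 + n * s ^ 2) ^ 3 * Real.exp (-(n * s ^ 2) / 4) := by
  have hK0 : 0 < K := by linarith
  have hs1 : |s| ≤ 1 / 28 := hs.trans (by
    apply div_le_div_of_nonneg_left <;> linarith)
  have hsK : 28 * (K * |s|) ≤ 1 := by
    rw [le_div_iff₀ (by positivity)] at hs; linarith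
  have hs0 := abs_nonneg s
  have hss : s ^ 2 = |s| ^ 2 := (sq_abs s).symm
  have hs4 : s ^ 4 = |s| ^ 4 := by rw [pow_abs, abs_of_nonneg (by positivity)]
  obtain ⟨m, rfl⟩ : ∃ m, n = m + 2 := ⟨n - 2, by omega⟩
  simp only [Nat.add_sub_cancel]
  set v := Real.exp (-(s ^ 2) / 2) with hv
  set a : ℂ := -(I * γ * s ^ 3 / 6) with ha
  have hv0 : 0 < v := Real.exp_pos _
  have hva : |v - 1 - -(s ^ 2) / 2| ≤ s ^ 4 := by
    have := Real.abs_exp_sub_one_sub_id_le (x := -(s ^ 2) / 2) (by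
      rw [abs_le]; constructor <;> nlinarith)
    refine this.trans ?_
    nlinarith [sq_nonneg (s ^ 2)]
  have hv1 : v ≤ 1 := Real.exp_le_one_iff.2 (by nlinarith [sq_nonneg s])
  have hvs : 1 - v ≤ s ^ 2 := by
    have := Real.add_one_le_exp (-(s ^ 2) / 2)
    nlinarith [sq_nonneg s]
  have hv2 : 1 / 2 ≤ v := by nlinarith
  have hna : ‖a‖ ≤ K * |s| ^ 3 := by
    rw [ha, norm_neg]
    simp only [norm_div, norm_mul, Complex.norm_I, Complex.norm_real, Real.norm_eq_abs, norm_pow,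
      Complex.norm_ofNat, one_mul]
    have : |γ| * |s| ^ 3 ≤ K * |s| ^ 3 := by gcongr
    have : 0 ≤ |γ| * |s| ^ 3 := by positivity
    linarith
  have hz : ‖z0 - v * (1 + a)‖ ≤ 3 * K * s ^ 4 := by
    have e : z0 - v * (1 + a) = (z0 - (1 - s ^ 2 / 2 - I * γ * s ^ 3 / 6)) -
        ((v - 1 - -(s ^ 2) / 2 : ℝ) : ℂ) + a * ((1 - v : ℝ) : ℂ) := by
      rw [ha]; push_cast; ring
    rw [e]
    refine (norm_add_le _ _).trans ?_
    refine (add_le_add_left (norm_sub_le _ _) _).trans ?_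
    rw [norm_mul, Complex.norm_real, Complex.norm_real, Real.norm_eq_abs, Real.norm_eq_abs,
      abs_of_nonneg (by linarith : 0 ≤ 1 - v)]
    have : ‖a‖ * (1 - v) ≤ K * |s| ^ 3 * s ^ 2 := by gcongr
    have : K * |s| ^ 3 * s ^ 2 ≤ K * s ^ 4 := by
      rw [hss, hs4]
      have : K * |s| ^ 4 * |s| ≤ K * |s| ^ 4 * 1 := by gcongr; linarith
      linarith
    have : 0 ≤ s ^ 4 := by positivity
    nlinarith
  set r : ℂ := z0 / v with hr
  have hvC : (v : ℂ) ≠ 0 := by exact_mod_cast hv0.ne'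
  have hzr : z0 = v * r := by rw [hr]; field_simp
  have hra : ‖r - 1 - a‖ ≤ 6 * K * s ^ 4 := by
    have e : z0 - v * (1 + a) = v * (r - 1 - a) := by rw [hzr]; ring
    rw [e, norm_mul, Complex.norm_real, Real.norm_eq_abs, abs_of_pos hv0] at hz
    nlinarith [norm_nonneg (r - 1 - a)]
  have hr1 : ‖r - 1‖ ≤ 7 * K * |s| ^ 3 := by
    have : ‖r - 1‖ ≤ ‖r - 1 - a‖ + ‖a‖ := by simpa using norm_add_le (r - 1 - a) a
    have : 6 * K * s ^ 4 ≤ 6 * K * |s| ^ 3 := by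
      rw [hs4]
      have : 6 * K * |s| ^ 3 * |s| ≤ 6 * K * |s| ^ 3 * 1 := by gcongr; linarith
      linarith
    linarith
  have hr2 : ‖r - 1‖ ≤ s ^ 2 / 4 := by
    refine hr1.trans ?_
    rw [hss]
    have : 28 * (K * |s|) * |s| ^ 2 ≤ 1 * |s| ^ 2 := by gcongr
    linarith
  set N : ℝ := ((m + 2 : ℕ) : ℝ) with hN
  have hNm : (m : ℝ) = N - 2 := by rw [hN]; push_cast; ring
  have hN2 : 2 ≤ N := by rw [hN]; push_cast; linarith [(Nat.cast_nonneg m : (0 : ℝ) ≤ m)]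
  have hm0 : (0 : ℝ) ≤ m := Nat.cast_nonneg m
  set q := N * s ^ 2 with hq
  have hq0 : 0 ≤ q := by positivity
  have hexp : v ^ m * Real.exp (m * (s ^ 2 / 4)) ≤ 2 * Real.exp (-q / 4) := by
    rw [hv, ← Real.exp_nat_mul, ← Real.exp_add]
    have h1 : (m : ℝ) * (-(s ^ 2) / 2) + m * (s ^ 2 / 4) = s ^ 2 / 2 + -q / 4 := by
      rw [hNm, hq]; ring
    rw [h1, Real.exp_add]
    gcongr
    have h2 : Real.exp (s ^ 2 / 2) = v⁻¹ := by rw [hv, ← Real.exp_neg]; ring_nf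
    rw [h2]
    exact inv_le_of_inv_le₀ (by norm_num) (by linarith)
  have hrm : ‖r‖ ^ m ≤ Real.exp (m * (s ^ 2 / 4)) := by
    rw [Real.exp_nat_mul]
    gcongr
    have : ‖r‖ ≤ ‖r - 1‖ + ‖(1 : ℂ)‖ := by simpa using norm_add_le (r - 1) 1
    rw [norm_one] at this
    linarith [Real.add_one_le_exp (s ^ 2 / 4)]
  constructor
  · rw [norm_pow, hzr, norm_mul, Complex.norm_real, Real.norm_eq_abs, abs_of_pos hv0, mul_pow]
    exact (mul_le_mul_of_nonneg_left hrm (by positivity)).trans hexp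
  have hvN : Real.exp (-q / 2) = v ^ m * v ^ 2 := by
    rw [← pow_add, hv, ← Real.exp_nat_mul]
    congr 1
    rw [hq, hN]; ring
  have e : z0 ^ m - Real.exp (-q / 2) * (1 - (m + 2 : ℕ) * (I * γ * s ^ 3 / 6)) =
      (v : ℂ) ^ m * ((r ^ m - 1 - m * (r - 1)) + m * (r - 1 - a) - 2 * a +
        ((1 - v ^ 2 : ℝ) : ℂ) * (1 + (m + 2 : ℕ) * a)) := by
    rw [hvN, hzr, ha, mul_pow]; push_cast; ring
  have hE1 : 1 ≤ Real.exp (m * (s ^ 2 / 4)) := Real.one_le_exp (by positivity)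
  have hb1 : ‖r ^ m - 1 - m * (r - 1)‖ ≤
      49 * K ^ 2 * q ^ 3 / N * Real.exp (m * (s ^ 2 / 4)) := by
    refine (norm_pow_sub_one_sub_le r m).trans ?_
    have h1 : (m : ℝ) ^ 2 * ‖r - 1‖ ^ 2 ≤ N ^ 2 * (7 * K * |s| ^ 3) ^ 2 := by
      gcongr; linarith
    have h2 : N ^ 2 * (7 * K * |s| ^ 3) ^ 2 = 49 * K ^ 2 * q ^ 3 / N := by
      rw [hq, hss]; field_simp; ring
    rw [← h2]
    gcongr
  have hb2 : ‖(m : ℂ) * (r - 1 - a)‖ ≤ 6 * K * q ^ 2 / N := by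
    rw [norm_mul, Complex.norm_natCast]
    have h2 : N * (6 * K * s ^ 4) = 6 * K * q ^ 2 / N := by rw [hq]; field_simp
    rw [← h2]
    gcongr
    linarith
  have has : ‖a‖ ≤ K * s ^ 2 := hna.trans (by
    rw [hss]
    have : K * |s| ^ 2 * |s| ≤ K * |s| ^ 2 * 1 := by gcongr; linarith
    linarith)
  have hsq : s ^ 2 = q / N := by rw [hq]; field_simp
  have hb3 : ‖2 * a‖ ≤ 2 * K * q / N := by
    rw [norm_mul, Complex.norm_ofNat, mul_div_assoc, ← hsq]; linarith
  have hb4 : ‖((1 - v ^ 2 : ℝ) : ℂ) * (1 + (m + 2 : ℕ) * a)‖ ≤ 2 * q / N * (1 + K * q) := by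
    rw [norm_mul, Complex.norm_real, Real.norm_eq_abs, abs_of_nonneg (by nlinarith)]
    have h1 : 1 - v ^ 2 ≤ 2 * q / N := by rw [mul_div_assoc, ← hsq]; nlinarith
    have h2 : ‖1 + ((m + 2 : ℕ) : ℂ) * a‖ ≤ 1 + K * q := by
      refine (norm_add_le _ _).trans ?_
      rw [norm_one, norm_mul, Complex.norm_natCast, ← hN]
      have : N * ‖a‖ ≤ N * (K * s ^ 2) := by gcongr
      rw [hq]; linarith
    gcongr
  rw [e, norm_mul, norm_pow, Complex.norm_real, Real.norm_eq_abs, abs_of_pos hv0]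
  have htot : ‖(r ^ m - 1 - m * (r - 1)) + m * (r - 1 - a) - 2 * a +
        ((1 - v ^ 2 : ℝ) : ℂ) * (1 + (m + 2 : ℕ) * a)‖ ≤
      60 * K ^ 2 / N * (1 + q) ^ 3 * Real.exp (m * (s ^ 2 / 4)) := by
    have h1 := norm_add_le ((r ^ m - 1 - m * (r - 1)) + m * (r - 1 - a) - 2 * a)
      (((1 - v ^ 2 : ℝ) : ℂ) * (1 + (m + 2 : ℕ) * a))
    have h2 := norm_sub_le ((r ^ m - 1 - m * (r - 1)) + m * (r - 1 - a)) (2 * a)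
    have h3 := norm_add_le (r ^ m - 1 - m * (r - 1)) ((m : ℂ) * (r - 1 - a))
    have h5 : 6 * K * q ^ 2 / N + 2 * K * q / N + 2 * q / N * (1 + K * q) ≤
        (6 * K * q ^ 2 / N + 2 * K * q / N + 2 * q / N * (1 + K * q)) *
          Real.exp (m * (s ^ 2 / 4)) := le_mul_of_one_le_right (by positivity) hE1
    have h6 := error_polynomial_le hK hq0 (N := N) (by linarith)
    have h7 := mul_le_mul_of_nonneg_right h6 (Real.exp_pos (m * (s ^ 2 / 4))).le
    linarith
  calc _ ≤ v ^ m * (60 * K ^ 2 / N * (1 + q) ^ 3 * Real.exp (m * (s ^ 2 / 4))) := by gcongr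
    _ = 60 * K ^ 2 / N * (1 + q) ^ 3 * (v ^ m * Real.exp (m * (s ^ 2 / 4))) := by ring
    _ ≤ 60 * K ^ 2 / N * (1 + q) ^ 3 * (2 * Real.exp (-q / 4)) := by gcongr
    _ = _ := by ring

lemma norm_core_factor_sub_le (hK : 1 ≤ K) (hγ : |γ| ≤ K) (hs : |s| ≤ 1)
    (h0 : ‖z0 - (1 - s ^ 2 / 2 - I * γ * s ^ 3 / 6)‖ ≤ K * s ^ 4)
    (h1 : ‖z1 - (I * s - γ * s ^ 2 / 2)‖ ≤ K * |s| ^ 3)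
    (h2 : ‖z2 - (1 + I * γ * s)‖ ≤ K * s ^ 2) {N : ℝ} (hN : 1 ≤ N) :
    ‖z0 ^ 2 + z2 * z0 + (N - 1) * z1 ^ 2 - (2 + I * γ * s - N * s ^ 2 - I * γ * N * s ^ 3)‖ ≤
      40 * K ^ 2 / N * (1 + N * s ^ 2) ^ 2 := by
  have hK0 : 0 < K := by linarith
  have hs0 := abs_nonneg s
  have hss : s ^ 2 = |s| ^ 2 := (sq_abs s).symm
  have hs4 : s ^ 4 = |s| ^ 4 := by rw [pow_abs, abs_of_nonneg (by positivity)]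
  have hγ0 := abs_nonneg γ
  have hs3 : |s| ^ 3 ≤ |s| ^ 2 := pow_le_pow_of_le_one hs0 hs (by norm_num)
  have hs42 : |s| ^ 4 ≤ |s| ^ 2 := pow_le_pow_of_le_one hs0 hs (by norm_num)
  have hs21 : |s| ^ 2 ≤ |s| := by simpa using pow_le_pow_of_le_one hs0 hs (show 1 ≤ 2 by norm_num)
  have hs31 : |s| ^ 3 ≤ |s| := by simpa using pow_le_pow_of_le_one hs0 hs (show 1 ≤ 3 by norm_num)
  have hz0 : ‖z0 - 1‖ ≤ 3 * K * |s| ^ 2 := by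
    have e : z0 - 1 = (z0 - (1 - s ^ 2 / 2 - I * γ * s ^ 3 / 6)) +
      (-(s ^ 2 / 2 : ℂ) - I * γ * s ^ 3 / 6) := by ring
    have n1 : ‖-(s ^ 2 / 2 : ℂ) - I * γ * s ^ 3 / 6‖ ≤ |s| ^ 2 / 2 + |γ| * |s| ^ 3 / 6 := by
      refine (norm_sub_le _ _).trans_eq ?_
      simp
    rw [e]
    refine (norm_add_le _ _).trans ?_
    have : K * s ^ 4 ≤ K * |s| ^ 2 := by rw [hs4]; gcongr
    have : |γ| * |s| ^ 3 ≤ K * |s| ^ 2 := by gcongr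
    have : 1 * |s| ^ 2 ≤ K * |s| ^ 2 := by gcongr
    have : 0 ≤ K * |s| ^ 2 := by positivity
    linarith
  have hz0' : ‖z0‖ ≤ 4 * K := by
    have : ‖z0‖ ≤ ‖z0 - 1‖ + ‖(1 : ℂ)‖ := by simpa using norm_add_le (z0 - 1) 1
    rw [norm_one] at this
    have : 3 * K * |s| ^ 2 ≤ 3 * K * 1 := by gcongr; linarith
    linarith
  have hγs : ‖1 + I * γ * s‖ ≤ 2 * K := by
    refine (norm_add_le _ _).trans ?_
    have : |γ| * |s| ≤ K * 1 := by gcongr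
    simp
    linarith
  set w : ℂ := I * s - γ * s ^ 2 / 2 with hw
  have hwn : ‖w‖ ≤ 2 * K * |s| := by
    rw [hw]
    refine (norm_sub_le _ _).trans ?_
    simp
    have : |γ| * |s| ^ 2 ≤ K * |s| := by gcongr
    have : 1 * |s| ≤ K * |s| := by gcongr
    rw [hss]
    have : 0 ≤ K * |s| := by positivity
    linarith
  have hz1 : ‖z1‖ ≤ 3 * K * |s| := by
    have : ‖z1‖ ≤ ‖z1 - w‖ + ‖w‖ := by simpa using norm_add_le (z1 - w) w
    have : K * |s| ^ 3 ≤ K * |s| := by gcongr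
    linarith
  have hw2 : ‖w ^ 2 + s ^ 2 + I * γ * s ^ 3‖ ≤ K ^ 2 * |s| ^ 4 := by
    have e : w ^ 2 + s ^ 2 + I * γ * s ^ 3 = (γ : ℂ) ^ 2 * s ^ 4 / 4 := by
      rw [hw]
      linear_combination (s : ℂ) ^ 2 * Complex.I_sq
    rw [e]
    simp only [norm_div, norm_mul, norm_pow, Complex.norm_real, Real.norm_eq_abs,
      Complex.norm_ofNat]
    have : |γ| ^ 2 * |s| ^ 4 ≤ K ^ 2 * |s| ^ 4 := by gcongr
    have : 0 ≤ |γ| ^ 2 * |s| ^ 4 := by positivity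
    linarith
  have e : z0 ^ 2 + z2 * z0 + (N - 1) * z1 ^ 2 -
      (2 + I * γ * s - N * s ^ 2 - I * γ * N * s ^ 3) =
      (z0 - 1) * (z0 + 1) + ((z2 - (1 + I * γ * s)) * z0 + (1 + I * γ * s) * (z0 - 1)) +
      (N * ((z1 - w) * (z1 + w)) + N * (w ^ 2 + s ^ 2 + I * γ * s ^ 3)) - z1 ^ 2 := by ring
  have b1 : ‖(z0 - 1) * (z0 + 1)‖ ≤ 3 * K * |s| ^ 2 * (5 * K) := by
    rw [norm_mul]
    gcongr
    refine (norm_add_le _ _).trans ?_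
    rw [norm_one]; linarith
  have b2 : ‖(z2 - (1 + I * γ * s)) * z0‖ ≤ K * |s| ^ 2 * (4 * K) := by
    rw [norm_mul, ← hss]; gcongr
  have b3 : ‖(1 + I * γ * s) * (z0 - 1)‖ ≤ 2 * K * (3 * K * |s| ^ 2) := by
    rw [norm_mul]; gcongr
  have b4 : ‖(N : ℂ) * ((z1 - w) * (z1 + w))‖ ≤ N * (K * |s| ^ 3 * (5 * K * |s|)) := by
    rw [norm_mul, norm_mul, Complex.norm_real, Real.norm_eq_abs, abs_of_nonneg (by linarith)]
    gcongr
    refine (norm_add_le _ _).trans ?_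
    linarith
  have b5 : ‖(N : ℂ) * (w ^ 2 + s ^ 2 + I * γ * s ^ 3)‖ ≤ N * (K ^ 2 * |s| ^ 4) := by
    rw [norm_mul, Complex.norm_real, Real.norm_eq_abs, abs_of_nonneg (by linarith)]
    gcongr
  have b6 : ‖z1 ^ 2‖ ≤ (3 * K * |s|) ^ 2 := by rw [norm_pow]; gcongr
  rw [e]
  have t1 := norm_sub_le ((z0 - 1) * (z0 + 1) + ((z2 - (1 + I * γ * s)) * z0 +
    (1 + I * γ * s) * (z0 - 1)) +
      (N * ((z1 - w) * (z1 + w)) + N * (w ^ 2 + s ^ 2 + I * γ * s ^ 3))) (z1 ^ 2)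
  have t2 := norm_add_le ((z0 - 1) * (z0 + 1) + ((z2 - (1 + I * γ * s)) * z0 +
    (1 + I * γ * s) * (z0 - 1)))
      (N * ((z1 - w) * (z1 + w)) + N * (w ^ 2 + s ^ 2 + I * γ * s ^ 3))
  have t3 := norm_add_le (N * ((z1 - w) * (z1 + w))) (N * (w ^ 2 + s ^ 2 + I * γ * s ^ 3))
  have t4 := norm_add_le ((z0 - 1) * (z0 + 1)) ((z2 - (1 + I * γ * s)) * z0 +
    (1 + I * γ * s) * (z0 - 1))
  have t5 := norm_add_le ((z2 - (1 + I * γ * s)) * z0) ((1 + I * γ * s) * (z0 - 1))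
  have hfin : 3 * K * |s| ^ 2 * (5 * K) + (K * |s| ^ 2 * (4 * K) + 2 * K * (3 * K * |s| ^ 2)) +
      (N * (K * |s| ^ 3 * (5 * K * |s|)) + N * (K ^ 2 * |s| ^ 4)) + (3 * K * |s|) ^ 2 ≤
      40 * K ^ 2 / N * (1 + N * s ^ 2) ^ 2 := by
    have e2 : 40 * K ^ 2 / N * (1 + N * s ^ 2) ^ 2 =
        40 * K ^ 2 / N + 80 * (K ^ 2 * |s| ^ 2) + 40 * (N * (K ^ 2 * |s| ^ 4)) := by
      rw [hss]; field_simp; ring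
    rw [e2]
    have : 0 ≤ 40 * K ^ 2 / N := by positivity
    have : 0 ≤ K ^ 2 * |s| ^ 2 := by positivity
    have : 0 ≤ N * (K ^ 2 * |s| ^ 4) := by positivity
    nlinarith
  linarith

/-- Edgeworth approximation of the transform of `(1 + x ^ 2)` times the law of a normalized sum,
near the origin. -/
lemma norm_core_sub_edgeworthTransform_le (hK : 1 ≤ K) (hγ : |γ| ≤ K) (hs : |s| ≤ 1 / (28 * K))
    (h0 : ‖z0 - (1 - s ^ 2 / 2 - I * γ * s ^ 3 / 6)‖ ≤ K * s ^ 4)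
    (h1 : ‖z1 - (I * s - γ * s ^ 2 / 2)‖ ≤ K * |s| ^ 3)
    (h2 : ‖z2 - (1 + I * γ * s)‖ ≤ K * s ^ 2) {n : ℕ} (hn : 2 ≤ n) :
    ‖z0 ^ (n - 2) * (z0 ^ 2 + z2 * z0 + (n - 1) * z1 ^ 2) - edgeworthTransform γ n s‖ ≤
      441 * K ^ 3 / n * (1 + n * s ^ 2) ^ 4 * Real.exp (-(n * s ^ 2) / 4) := by
  obtain ⟨hA, hB⟩ := norm_pow_sub_gaussian_le hK hγ hs h0 hn
  have hK0 : 0 < K := by linarith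
  have hs1 : |s| ≤ 1 := hs.trans (by rw [div_le_one (by positivity)]; linarith)
  have hN1 : (1 : ℝ) ≤ n := by exact_mod_cast (by omega : 1 ≤ n)
  have hQ := norm_core_factor_sub_le hK hγ hs1 h0 h1 h2 hN1
  have hss : s ^ 2 = |s| ^ 2 := (sq_abs s).symm
  have hs0 := abs_nonneg s
  have hγ0 := abs_nonneg γ
  rw [Complex.ofReal_natCast] at hQ
  set N : ℝ := (n : ℝ) with hN
  set q := N * s ^ 2 with hq
  have hq0 : 0 ≤ q := by positivity
  have hqs : N * |s| ^ 2 = q := by rw [hq, hss]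
  have hs3 : |s| ^ 3 ≤ |s| ^ 2 := pow_le_pow_of_le_one hs0 hs1 (by norm_num)
  set Q := z0 ^ 2 + z2 * z0 + (n - 1) * z1 ^ 2 with hQd
  set Q0 : ℂ := 2 + I * γ * s - n * s ^ 2 - I * γ * n * s ^ 3 with hQ0d
  set g := Real.exp (-q / 2) with hg
  set G := Real.exp (-q / 4) with hG
  have hgG : g ≤ G := Real.exp_le_exp.2 (by linarith)
  have hG0 : 0 < G := Real.exp_pos _
  have hQ0 : ‖Q0‖ ≤ 3 * K * (1 + q) := by
    have t1 := norm_sub_le (2 + I * γ * s - n * s ^ 2) (I * γ * n * s ^ 3)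
    have t2 := norm_sub_le (2 + I * γ * s) (n * s ^ 2)
    have t3 := norm_add_le 2 (I * γ * s)
    simp only [norm_mul, norm_pow, Complex.norm_I, Complex.norm_real, Real.norm_eq_abs,
      Complex.norm_natCast, Complex.norm_ofNat, one_mul] at t1 t2 t3
    rw [← hN] at t1 t2
    have : |γ| * |s| ≤ K * 1 := by gcongr
    have : |γ| * N * |s| ^ 3 ≤ K * N * |s| ^ 2 := by gcongr
    have : K * N * |s| ^ 2 = K * q := by rw [← hqs]; ring
    have : 1 * q ≤ K * q := by gcongr
    have : 0 ≤ K * q := by positivity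
    linarith
  have hcross : ‖(g : ℂ) * ((γ : ℂ) ^ 2 / 6 * (n * s ^ 4 - n ^ 2 * s ^ 6))‖ ≤
      G * (K ^ 2 / N * (1 + q) ^ 4) := by
    rw [norm_mul, Complex.norm_real, Real.norm_eq_abs, abs_of_pos (Real.exp_pos _)]
    gcongr
    have e1 : (γ : ℂ) ^ 2 / 6 * (n * s ^ 4 - n ^ 2 * s ^ 6) =
        ((γ ^ 2 / 6 * ((q ^ 2 - q ^ 3) / N) : ℝ) : ℂ) := by
      have : (q ^ 2 - q ^ 3) / N = N * s ^ 4 - N ^ 2 * s ^ 6 := by rw [hq]; field_simp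
      rw [this, hN]; push_cast; ring
    rw [e1, Complex.norm_real, Real.norm_eq_abs, abs_mul, abs_div, abs_div, abs_of_pos
      (show 0 < N by linarith), abs_pow, abs_of_pos (show (0 : ℝ) < 6 by norm_num)]
    have h3 : |q ^ 2 - q ^ 3| ≤ (1 + q) ^ 4 := by
      have p1 : 0 ≤ q ^ 2 := by positivity
      have p2 : 0 ≤ q ^ 3 := by positivity
      have p3 : 0 ≤ q ^ 4 := by positivity
      rw [abs_le]; constructor <;> nlinarith
    have h4 : |γ| ^ 2 / 6 ≤ K ^ 2 := by
      have : |γ| ^ 2 ≤ K ^ 2 := by gcongr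
      have : 0 ≤ K ^ 2 := by positivity
      linarith
    calc |γ| ^ 2 / 6 * (|q ^ 2 - q ^ 3| / N) ≤ K ^ 2 * ((1 + q) ^ 4 / N) := by gcongr
      _ = _ := by ring
  have e : z0 ^ (n - 2) * Q - edgeworthTransform γ n s =
      z0 ^ (n - 2) * (Q - Q0) +
        Q0 * (z0 ^ (n - 2) - g * (1 - n * (I * γ * s ^ 3 / 6))) +
        (g : ℂ) * ((γ : ℂ) ^ 2 / 6 * (n * s ^ 4 - n ^ 2 * s ^ 6)) := by
    rw [edgeworthTransform, hQ0d]
    linear_combination -(g : ℂ) * (γ : ℂ) ^ 2 / 6 * (n * s ^ 4 - n ^ 2 * s ^ 6) * Complex.I_sq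
  rw [e]
  refine (norm_add_le _ _).trans ((add_le_add_left (norm_add_le _ _) _).trans ?_)
  rw [norm_mul, norm_mul (Q0)]
  have k1 : ‖z0 ^ (n - 2)‖ * ‖Q - Q0‖ ≤ 2 * G * (40 * K ^ 2 / N * (1 + q) ^ 2) := by gcongr
  have k2 : ‖Q0‖ * ‖z0 ^ (n - 2) - g * (1 - n * (I * γ * s ^ 3 / 6))‖ ≤
      3 * K * (1 + q) * (120 * K ^ 2 / N * (1 + q) ^ 3 * G) := by gcongr
  have hq1 : (1 + q) ^ 2 ≤ (1 + q) ^ 4 := pow_le_pow_right₀ (by linarith) (by norm_num)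
  have hKK : K ^ 2 ≤ K ^ 3 := pow_le_pow_right₀ hK (by norm_num)
  have k1' : 2 * G * (40 * K ^ 2 / N * (1 + q) ^ 2) ≤ 2 * G * (40 * K ^ 3 / N * (1 + q) ^ 4) := by
    gcongr
  have k3' : G * (K ^ 2 / N * (1 + q) ^ 4) ≤ G * (K ^ 3 / N * (1 + q) ^ 4) := by gcongr
  have : 2 * G * (40 * K ^ 3 / N * (1 + q) ^ 4) + 3 * K * (1 + q) * (120 * K ^ 2 / N * (1 + q) ^ 3 * G)
      + G * (K ^ 3 / N * (1 + q) ^ 4) = 441 * K ^ 3 / N * (1 + q) ^ 4 * G := by ring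
  linarith

end core

section momentChar

lemma continuous_momentChar {α : Type*} [MeasurableSpace α] {μ : Measure α} {Y : α → ℝ}
    (hY : Measurable Y) {j : ℕ} (hj : Integrable (fun k => Y k ^ j) μ) :
    Continuous (momentChar μ Y j) := by
  refine continuous_of_dominated (fun s => by fun_prop) (fun s => .of_forall fun k => ?_) hj.norm
    (.of_forall fun k => by fun_prop)
  rw [norm_mul, Complex.norm_exp_ofReal_mul_I]; simp

variable {α : Type*} [MeasurableSpace α] {μ : Measure α} [IsProbabilityMeasure μ] {Y : α → ℝ}

/-- The transform of `1 + W ^ 2` against the law of the normalized sum `W` of `n` copies of `Y`,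
at `s * √n`. -/
noncomputable def sumTransform (μ : Measure α) (Y : α → ℝ) (n : ℕ) (s : ℝ) : ℂ :=
  momentChar μ Y 0 s ^ (n - 2) * (momentChar μ Y 0 s ^ 2 + momentChar μ Y 2 s * momentChar μ Y 0 s +
    (n - 1) * momentChar μ Y 1 s ^ 2)

lemma norm_momentChar_zero_le (s : ℝ) : ‖momentChar μ Y 0 s‖ ≤ 1 := by
  refine (norm_integral_le_of_norm_le (integrable_const (1 : ℝ)) (.of_forall fun k => ?_)).trans ?_
  · rw [norm_mul, Complex.norm_exp_ofReal_mul_I]; simp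
  · simp

lemma norm_momentChar_one_le (hY : Measurable Y) (h4 : Integrable (fun k => Y k ^ 4) μ)
    (hY1 : ∫ k, Y k ∂μ = 0) (hY2 : ∫ k, Y k ^ 2 ∂μ = 1) (s : ℝ) :
    ‖momentChar μ Y 1 s‖ ≤ |s| := by
  have i1 := integrable_pow_of_pow_four hY h4 (show 1 ≤ 4 by norm_num)
  have e : momentChar μ Y 1 s =
      ∫ k, ((Y k : ℂ) ^ 1 * Complex.exp ((s * Y k : ℝ) * I) - ((Y k ^ 1 : ℝ) : ℂ)) ∂μ := by
    rw [integral_sub (integrable_momentChar hY h4 (j := 1) (by norm_num) s) (by exact i1.ofReal),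
      integral_complex_ofReal]
    simp [hY1, momentChar]
  rw [e]
  have i2 := integrable_pow_of_pow_four hY h4 (show 2 ≤ 4 by norm_num)
  refine (norm_integral_le_of_norm_le (i2.const_mul |s|) (.of_forall fun k => ?_)).trans_eq ?_
  · have h : ‖Complex.exp ((s * Y k : ℝ) * I) - 1‖ ≤ |s * Y k| := by
      rw [mul_comm]; exact Real.norm_exp_I_mul_ofReal_sub_one_le
    have e2 : (Y k : ℂ) ^ 1 * Complex.exp ((s * Y k : ℝ) * I) - ((Y k ^ 1 : ℝ) : ℂ) =
      Y k * (Complex.exp ((s * Y k : ℝ) * I) - 1) := by push_cast; ring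
    rw [e2, norm_mul, Complex.norm_real, Real.norm_eq_abs]
    calc _ ≤ |Y k| * |s * Y k| := by gcongr
      _ = |s| * Y k ^ 2 := by rw [abs_mul, ← sq_abs (Y k)]; ring
  · rw [integral_const_mul, hY2, mul_one]

lemma norm_momentChar_two_le (hY : Measurable Y) (h4 : Integrable (fun k => Y k ^ 4) μ)
    (hY2 : ∫ k, Y k ^ 2 ∂μ = 1) (s : ℝ) : ‖momentChar μ Y 2 s‖ ≤ 1 := by
  have i2 := integrable_pow_of_pow_four hY h4 (show 2 ≤ 4 by norm_num)
  refine (norm_integral_le_of_norm_le i2 (.of_forall fun k => ?_)).trans_eq hY2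
  rw [norm_mul, Complex.norm_exp_ofReal_mul_I]; simp

/-- Taylor expansions at the origin of the transforms of a standardized variable. -/
lemma exists_momentChar_taylor (hY : Measurable Y) (h4 : Integrable (fun k => Y k ^ 4) μ) {γ : ℝ}
    (hY1 : ∫ k, Y k ∂μ = 0) (hY2 : ∫ k, Y k ^ 2 ∂μ = 1) (hY3 : ∫ k, Y k ^ 3 ∂μ = γ) :
    ∃ K : ℝ, 1 ≤ K ∧ |γ| ≤ K ∧ ∀ s : ℝ,
      ‖momentChar μ Y 0 s - (1 - s ^ 2 / 2 - I * γ * s ^ 3 / 6)‖ ≤ K * s ^ 4 ∧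
      ‖momentChar μ Y 1 s - (I * s - γ * s ^ 2 / 2)‖ ≤ K * |s| ^ 3 ∧
      ‖momentChar μ Y 2 s - (1 + I * γ * s)‖ ≤ K * s ^ 2 := by
  set β := ∫ k, Y k ^ 4 ∂μ with hβ
  have hβ0 : 0 ≤ β := integral_nonneg fun k => by positivity
  refine ⟨1 + |γ| + 5 * β, by have := abs_nonneg γ; linarith, by linarith, fun s => ⟨?_, ?_, ?_⟩⟩
  · have h := norm_momentChar_sub_le hY h4 (j := 0) (m := 4) (by norm_num) (by norm_num) s
    simp only [Finset.sum_range_succ, Finset.sum_range_zero, hY1, hY2, hY3, Nat.factorial,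
      zero_add, pow_zero, pow_one, integral_const, probReal_univ, smul_eq_mul] at h
    have hs4 : s ^ 4 = |s| ^ 4 := by rw [pow_abs, abs_of_nonneg (by positivity)]
    have e : momentChar μ Y 0 s - (1 - s ^ 2 / 2 - I * γ * s ^ 3 / 6) = momentChar μ Y 0 s -
        (1 / ((1 : ℕ) : ℂ) * ((1 * 1 : ℝ) : ℂ) + s * I / ((1 * 1 : ℕ) : ℂ) * ((0 : ℝ) : ℂ) +
        (s * I) ^ 2 / (((1 + 1) * (1 * 1) : ℕ) : ℂ) * ((1 : ℝ) : ℂ) +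
        (s * I) ^ 3 / (((2 + 1) * ((1 + 1) * (1 * 1)) : ℕ) : ℂ) * γ) := by
      push_cast
      linear_combination (s ^ 2 / 2 + (γ * s ^ 3 / 6) * I) * Complex.I_sq
    rw [e]
    refine h.trans ?_
    rw [hs4]
    push_cast
    nlinarith [show 0 ≤ |s| ^ 4 * (1 + |γ|) by positivity]
  · have h := norm_momentChar_sub_le hY h4 (j := 1) (m := 3) (by norm_num) (by norm_num) s
    simp only [Finset.sum_range_succ, Finset.sum_range_zero, hY1, hY2, hY3, Nat.factorial,
      zero_add, pow_zero, pow_one, Nat.reduceAdd, add_zero] at h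
    have e : momentChar μ Y 1 s - (I * s - γ * s ^ 2 / 2) = momentChar μ Y 1 s -
        (1 / ((1 : ℕ) : ℂ) * ((0 : ℝ) : ℂ) + s * I / ((1 * 1 : ℕ) : ℂ) * ((1 : ℝ) : ℂ) +
        (s * I) ^ 2 / ((2 * (1 * 1) : ℕ) : ℂ) * γ) := by
      push_cast
      linear_combination (γ * s ^ 2 / 2) * Complex.I_sq
    rw [e]
    refine h.trans ?_
    push_cast
    nlinarith [show 0 ≤ |s| ^ 3 * (1 + |γ|) by positivity, show 0 ≤ |s| ^ 3 * β by positivity]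
  · have h := norm_momentChar_sub_le hY h4 (j := 2) (m := 2) (by norm_num) (by norm_num) s
    simp only [Finset.sum_range_succ, Finset.sum_range_zero, hY2, hY3, Nat.factorial,
      zero_add, pow_zero, pow_one, Nat.reduceAdd, add_zero] at h
    have e : momentChar μ Y 2 s - (1 + I * γ * s) = momentChar μ Y 2 s -
        (1 / ((1 : ℕ) : ℂ) * ((1 : ℝ) : ℂ) + s * I / ((1 * 1 : ℕ) : ℂ) * γ) := by
      push_cast
      ring
    rw [e]
    refine h.trans ?_
    rw [sq_abs]
    push_cast
    nlinarith [show 0 ≤ s ^ 2 * (1 + |γ|) by positivity, show 0 ≤ s ^ 2 * β by positivity]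

/-- A characteristic function whose modulus is `1` only at the origin of `[-R, R]` is dominated
there by a Gaussian. -/
lemma exists_norm_momentChar_zero_le_exp (hY : Measurable Y) {K γ R : ℝ} (hR : 0 < R) (hK : 1 ≤ K)
    (hγ : |γ| ≤ K)
    (h0 : ∀ s : ℝ, ‖momentChar μ Y 0 s - (1 - s ^ 2 / 2 - I * γ * s ^ 3 / 6)‖ ≤ K * s ^ 4)
    (hlt : ∀ s : ℝ, s ≠ 0 → |s| ≤ R → ‖momentChar μ Y 0 s‖ < 1) :
    ∃ c : ℝ, 0 < c ∧ c ≤ 1 / 4 ∧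
      ∀ s : ℝ, |s| ≤ R → ‖momentChar μ Y 0 s‖ ≤ Real.exp (-c * s ^ 2) := by
  set ε := 1 / (28 * K) with hε
  have hK0 : 0 < K := by linarith
  have hε0 : 0 < ε := by positivity
  have hsmall : ∀ s : ℝ, |s| ≤ ε → ‖momentChar μ Y 0 s‖ ≤ Real.exp (-(1 / 4) * s ^ 2) := by
    intro s hs
    have hs0 := abs_nonneg s
    have hKs : 28 * (K * |s|) ≤ 1 := by
      rw [hε, le_div_iff₀ (by positivity)] at hs; linarith
    have hs1 : |s| ≤ 1 := by nlinarith
    have hss : s ^ 2 = |s| ^ 2 := (sq_abs s).symm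
    have hs4 : s ^ 4 = |s| ^ 4 := by rw [pow_abs, abs_of_nonneg (by positivity)]
    have t : ‖momentChar μ Y 0 s‖ ≤ ‖momentChar μ Y 0 s - (1 - s ^ 2 / 2 - I * γ * s ^ 3 / 6)‖ +
        ‖((1 - s ^ 2 / 2 : ℝ) : ℂ) - I * γ * s ^ 3 / 6‖ := by
      refine le_trans (le_of_eq ?_) (norm_add_le _ _)
      congr 1; push_cast; ring
    have t2 := norm_sub_le ((1 - s ^ 2 / 2 : ℝ) : ℂ) (I * γ * s ^ 3 / 6)
    have hs2 : |s| ^ 2 ≤ 1 := pow_le_one₀ hs0 hs1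
    rw [Complex.norm_real, Real.norm_eq_abs, abs_of_nonneg (by rw [hss]; linarith)] at t2
    simp only [norm_div, norm_mul, norm_pow, Complex.norm_I, Complex.norm_real, Real.norm_eq_abs,
      Complex.norm_ofNat, one_mul] at t2
    have t3 : |γ| * |s| ^ 3 ≤ K * |s| ^ 3 := by gcongr
    have t4 : 28 * (K * |s|) * |s| ^ 2 ≤ 1 * |s| ^ 2 := by gcongr
    have t5 : K * |s| ^ 3 * |s| ≤ K * |s| ^ 3 * 1 := by gcongr
    have := h0 s
    have := Real.add_one_le_exp (-(1 / 4) * s ^ 2)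
    have : 0 ≤ |s| ^ 2 := by positivity
    rw [hs4] at *
    rw [hss] at *
    linarith
  set S : Set ℝ := {s | ε ≤ |s| ∧ |s| ≤ R} with hS
  have hSc : IsCompact S := by
    refine (isCompact_Icc (a := -R) (b := R)).of_isClosed_subset ?_ fun s hs => abs_le.1 hs.2
    exact (isClosed_le continuous_const continuous_abs).inter
      (isClosed_le continuous_abs continuous_const)
  obtain ⟨ρ, hρ1, hρ⟩ : ∃ ρ : ℝ, ρ < 1 ∧ ∀ s ∈ S, ‖momentChar μ Y 0 s‖ ≤ ρ := by
    rcases S.eq_empty_or_nonempty with h | h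
    · exact ⟨0, by norm_num, by simp [h]⟩
    · obtain ⟨x, hx, hmax⟩ := hSc.exists_isMaxOn h (continuous_momentChar
          (μ := μ) (j := 0) hY (by simp)).norm.continuousOn
      exact ⟨_, hlt x (abs_pos.1 (hε0.trans_le hx.1)) hx.2, fun s hs => hmax hs⟩
  refine ⟨min (1 / 4) ((1 - ρ) / R ^ 2), lt_min (by norm_num) (div_pos (by linarith) (by positivity)),
    min_le_left _ _, fun s hs => ?_⟩
  rcases le_total |s| ε with h | h
  · refine (hsmall s h).trans (Real.exp_le_exp.2 ?_)
    have : min (1 / 4) ((1 - ρ) / R ^ 2) * s ^ 2 ≤ 1 / 4 * s ^ 2 := by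
      gcongr; exact min_le_left _ _
    linarith
  · refine (hρ s ⟨h, hs⟩).trans (le_trans ?_ (Real.add_one_le_exp _))
    have h2 : s ^ 2 ≤ R ^ 2 := by rw [← sq_abs s]; gcongr
    have h3 : min (1 / 4) ((1 - ρ) / R ^ 2) * s ^ 2 ≤ (1 - ρ) / R ^ 2 * R ^ 2 := by
      have : 0 ≤ (1 - ρ) / R ^ 2 := div_nonneg (by linarith) (by positivity)
      exact mul_le_mul (min_le_right _ _) h2 (by positivity) this
    rw [div_mul_cancel₀ _ (by positivity)] at h3
    linarith

lemma norm_edgeworthTransform_le {K γ : ℝ} (hK : 1 ≤ K) (hγ : |γ| ≤ K) {n : ℕ} (hn : 1 ≤ n)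
    (s : ℝ) : ‖edgeworthTransform γ n s‖ ≤
      10 * K * (1 + n * s ^ 2) ^ 3 * Real.exp (-(n * s ^ 2) / 2) := by
  have hN1 : (1 : ℝ) ≤ n := by exact_mod_cast hn
  have hK0 : 0 < K := by linarith
  set q : ℝ := n * s ^ 2 with hq
  have hss : s ^ 2 = |s| ^ 2 := (sq_abs s).symm
  have hs0 := abs_nonneg s
  have hq0 : 0 ≤ q := by positivity
  have hsq : |s| ≤ 1 + q := by
    have : 1 * s ^ 2 ≤ n * s ^ 2 := by gcongr
    nlinarith [sq_nonneg (|s| - 1)]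
  rw [edgeworthTransform, norm_mul, Complex.norm_real, Real.norm_eq_abs,
    abs_of_pos (Real.exp_pos _), ← hq, mul_comm]
  gcongr
  have t1 := norm_sub_le (2 - n * s ^ 2 : ℂ) (I * γ / 6 * (-(n ^ 2 * s ^ 5) + 8 * (n * s ^ 3) - 6 * s))
  have t2 := norm_sub_le (2 : ℂ) (n * s ^ 2)
  have t3 := norm_sub_le (-(n ^ 2 * s ^ 5) + 8 * (n * s ^ 3) : ℂ) (6 * s)
  have t4 := norm_add_le (-(n ^ 2 * s ^ 5) : ℂ) (8 * (n * s ^ 3))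
  simp only [norm_mul, norm_pow, norm_neg, norm_div, Complex.norm_I, Complex.norm_real,
    Real.norm_eq_abs, Complex.norm_natCast, Complex.norm_ofNat, one_mul] at t1 t2 t3 t4
  have e5 : (n : ℝ) ^ 2 * |s| ^ 5 = q ^ 2 * |s| := by rw [hq, hss]; ring
  have e3 : (n : ℝ) * |s| ^ 3 = q * |s| := by rw [hq, hss]; ring
  rw [e5, e3] at t4
  have b5 : q ^ 2 * |s| ≤ q ^ 2 * (1 + q) := by gcongr
  have b3 : q * |s| ≤ q * (1 + q) := by gcongr
  rw [← hss, ← hq] at t2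
  have b6 : |γ| / 6 * ‖(-(n ^ 2 * s ^ 5) + 8 * (n * s ^ 3) - 6 * s : ℂ)‖ ≤
      K / 6 * (q ^ 2 * (1 + q) + 8 * (q * (1 + q)) + 6 * (1 + q)) := by
    gcongr
    linarith
  have b7 : 1 * (2 + q) ≤ K * (2 + q) := by gcongr
  have : 0 ≤ K * q := by positivity
  have : 0 ≤ K * q ^ 2 := by positivity
  have : 0 ≤ K * q ^ 3 := by positivity
  nlinarith

/-- Uniform comparison of the transform of a normalized sum with its Edgeworth approximation. -/
lemma exists_sumTransform_bound (hY : Measurable Y) (h4 : Integrable (fun k => Y k ^ 4) μ) {γ R : ℝ}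
    (hY1 : ∫ k, Y k ∂μ = 0) (hY2 : ∫ k, Y k ^ 2 ∂μ = 1) (hY3 : ∫ k, Y k ^ 3 ∂μ = γ) (hR : 0 < R)
    (hlt : ∀ s : ℝ, s ≠ 0 → |s| ≤ R → ‖momentChar μ Y 0 s‖ < 1) :
    ∃ C c : ℝ, 0 ≤ C ∧ 0 < c ∧ ∀ n : ℕ, 2 ≤ n →
      (∀ s : ℝ, |s| ≤ R → ‖sumTransform μ Y n s - edgeworthTransform γ n s‖ ≤
        C / n * (1 + n * s ^ 2) ^ 4 * Real.exp (-c * (n * s ^ 2))) ∧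
      (∀ s : ℝ, R ≤ |s| → ‖edgeworthTransform γ n s‖ ≤
        C / n * (1 + n * s ^ 2) ^ 4 * Real.exp (-c * (n * s ^ 2))) := by
  obtain ⟨K, hK, hγ, hT⟩ := exists_momentChar_taylor hY h4 hY1 hY2 hY3
  obtain ⟨c, hc0, hc4, hc⟩ :=
    exists_norm_momentChar_zero_le_exp hY hR hK hγ (fun s => (hT s).1) hlt
  have hK0 : 0 < K := by linarith
  set ε := min (1 / (28 * K)) R with hε
  have hε0 : 0 < ε := lt_min (by positivity) hR
  set C1 := 441 * K ^ 3
  set C2 := 10 * K / ε ^ 2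
  set C3 := 2 * Real.exp (2 * c * R ^ 2) / ε ^ 2
  have hC1 : 0 ≤ C1 := by positivity
  have hC2 : 0 ≤ C2 := by positivity
  have hC3 : 0 ≤ C3 := by positivity
  refine ⟨C1 + C2 + C3, c, by positivity, hc0, fun n hn => ?_⟩
  have hN2 : (2 : ℝ) ≤ n := by exact_mod_cast hn
  have hN0 : (0 : ℝ) < n := by linarith
  have hone : ∀ s : ℝ, ε ≤ |s| → 1 ≤ (1 + n * s ^ 2) / (n * ε ^ 2) := by
    intro s hs
    rw [le_div_iff₀ (by positivity)]
    have : ε ^ 2 ≤ s ^ 2 := by rw [← sq_abs s]; gcongr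
    have : n * ε ^ 2 ≤ n * s ^ 2 := by gcongr
    linarith
  have hE : ∀ s : ℝ, ε ≤ |s| → ‖edgeworthTransform γ n s‖ ≤
        C2 / n * (1 + n * s ^ 2) ^ 4 * Real.exp (-c * (n * s ^ 2)) := by
    intro s hs
    have hq0 : 0 ≤ n * s ^ 2 := by positivity
    calc ‖edgeworthTransform γ n s‖
        ≤ 10 * K * (1 + n * s ^ 2) ^ 3 * Real.exp (-(n * s ^ 2) / 2) :=
          norm_edgeworthTransform_le hK hγ (by omega) s
      _ ≤ 10 * K * (1 + n * s ^ 2) ^ 3 * Real.exp (-c * (n * s ^ 2)) *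
          ((1 + n * s ^ 2) / (n * ε ^ 2)) := by
          refine le_trans ?_ (le_mul_of_one_le_right (by positivity) (hone s hs))
          gcongr
          nlinarith
      _ = _ := by simp only [C2]; field_simp
  have hmono : ∀ s C' : ℝ, C' ≤ C1 + C2 + C3 →
      C' / n * (1 + n * s ^ 2) ^ 4 * Real.exp (-c * (n * s ^ 2)) ≤
        (C1 + C2 + C3) / n * (1 + n * s ^ 2) ^ 4 * Real.exp (-c * (n * s ^ 2)) := by
    intro s C' h
    gcongr
  refine ⟨fun s hs => ?_, fun s hs => (hE s ((min_le_right _ _).trans hs)).trans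
    (hmono s _ (by linarith))⟩
  obtain ⟨hT0, hT1, hT2⟩ := hT s
  have hq0 : 0 ≤ n * s ^ 2 := by positivity
  rcases le_total |s| ε with h | h
  · refine (norm_core_sub_edgeworthTransform_le hK hγ (h.trans (min_le_left _ _)) hT0 hT1 hT2
      hn).trans (le_trans ?_ (hmono s C1 (by linarith)))
    gcongr
    nlinarith
  · have hS : ‖sumTransform μ Y n s‖ ≤
        C3 / n * (1 + n * s ^ 2) ^ 4 * Real.exp (-c * (n * s ^ 2)) := by
      have hpow : ‖momentChar μ Y 0 s ^ (n - 2)‖ ≤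
          Real.exp (2 * c * R ^ 2) * Real.exp (-c * (n * s ^ 2)) := by
        rw [norm_pow, ← Real.exp_add]
        refine (pow_le_pow_left₀ (norm_nonneg _) (hc s hs) _).trans ?_
        rw [← Real.exp_nat_mul, Nat.cast_sub hn]
        apply Real.exp_le_exp.2
        have : s ^ 2 ≤ R ^ 2 := by rw [← sq_abs s]; gcongr
        have : c * s ^ 2 ≤ c * R ^ 2 := by gcongr
        push_cast
        linarith
      have hfac : ‖momentChar μ Y 0 s ^ 2 + momentChar μ Y 2 s * momentChar μ Y 0 s +
          (n - 1) * momentChar μ Y 1 s ^ 2‖ ≤ 2 * (1 + n * s ^ 2) := by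
        have t1 := norm_add_le (momentChar μ Y 0 s ^ 2 + momentChar μ Y 2 s * momentChar μ Y 0 s)
          ((n - 1) * momentChar μ Y 1 s ^ 2)
        have t2 := norm_add_le (momentChar μ Y 0 s ^ 2) (momentChar μ Y 2 s * momentChar μ Y 0 s)
        have t3 : ‖momentChar μ Y 0 s ^ 2‖ ≤ 1 := by
          rw [norm_pow]; exact pow_le_one₀ (norm_nonneg _) (norm_momentChar_zero_le s)
        have t4 : ‖momentChar μ Y 2 s * momentChar μ Y 0 s‖ ≤ 1 := by
          rw [norm_mul]
          exact mul_le_one₀ (norm_momentChar_two_le hY h4 hY2 s) (norm_nonneg _)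
            (norm_momentChar_zero_le s)
        have t5 : ‖((n : ℂ) - 1) * momentChar μ Y 1 s ^ 2‖ ≤ n * s ^ 2 := by
          have : ((n : ℂ) - 1) = ((n - 1 : ℝ) : ℂ) := by push_cast; ring
          rw [norm_mul, norm_pow, this, Complex.norm_real, Real.norm_eq_abs,
            abs_of_nonneg (by linarith), ← sq_abs s]
          gcongr
          · linarith
          · exact norm_momentChar_one_le hY h4 hY1 hY2 s
        linarith
      rw [sumTransform, norm_mul]
      calc _ ≤ Real.exp (2 * c * R ^ 2) * Real.exp (-c * (n * s ^ 2)) * (2 * (1 + n * s ^ 2)) := by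
            gcongr
        _ ≤ Real.exp (2 * c * R ^ 2) * Real.exp (-c * (n * s ^ 2)) * (2 * (1 + n * s ^ 2) ^ 3) := by
            gcongr
            exact le_self_pow₀ (by linarith) (by norm_num)
        _ ≤ Real.exp (2 * c * R ^ 2) * Real.exp (-c * (n * s ^ 2)) * (2 * (1 + n * s ^ 2) ^ 3) *
            ((1 + n * s ^ 2) / (n * ε ^ 2)) := le_mul_of_one_le_right (by positivity) (hone s h)
        _ = _ := by simp only [C3]; field_simp
    refine (norm_sub_le _ _).trans ((add_le_add hS (hE s h)).trans ?_)
    have := hmono s (C2 + C3) (by linarith)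
    rw [add_div] at this
    linarith

end momentChar

section gaussian

lemma integrable_pow_mul_exp_neg_mul_sq {b : ℝ} (hb : 0 < b) (j : ℕ) :
    Integrable fun u : ℝ => u ^ j * Real.exp (-b * u ^ 2) := by
  simpa using integrable_rpow_mul_exp_neg_mul_sq hb
    (show (-1 : ℝ) < j by linarith [(Nat.cast_nonneg j : (0 : ℝ) ≤ j)])

/-- The Fourier integral of `u ^ j` times the Gaussian. -/
noncomputable def gaussianMoment (j : ℕ) (x : ℝ) : ℂ :=
  ∫ u : ℝ, (u : ℂ) ^ j * Complex.exp (-(u : ℂ) ^ 2 / 2 - I * x * u)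

lemma integrable_gaussianMoment (j : ℕ) (x : ℝ) :
    Integrable fun u : ℝ => (u : ℂ) ^ j * Complex.exp (-(u : ℂ) ^ 2 / 2 - I * x * u) := by
  refine (integrable_pow_mul_exp_neg_mul_sq (show (0 : ℝ) < 1 / 2 by norm_num) j).norm.mono'
    (by fun_prop) (.of_forall fun u => le_of_eq ?_)
  rw [norm_mul, norm_mul, Complex.norm_exp, Real.norm_eq_abs (Real.exp _),
    abs_of_pos (Real.exp_pos _)]
  have : (-(u : ℂ) ^ 2 / 2 - I * x * u).re = -(1 / 2) * u ^ 2 := by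
    have : (-(u : ℂ) ^ 2 / 2 - I * x * u) = ((-(1 / 2) * u ^ 2 : ℝ) : ℂ) + ((-x * u : ℝ) : ℂ) * I := by
      push_cast; ring
    rw [this]
    simp [-Complex.ofReal_mul, -Complex.ofReal_neg]
  rw [this]
  simp

lemma gaussianMoment_zero (x : ℝ) :
    gaussianMoment 0 x = (2 * Real.pi * gaussianPDFReal 0 1 x : ℝ) := by
  have h := fourierIntegral_gaussian (b := 1 / 2) (by norm_num) (-x : ℂ)
  have e : gaussianMoment 0 x =
      ∫ u : ℝ, Complex.exp (I * (-x) * u) * Complex.exp (-(1 / 2) * (u : ℂ) ^ 2) := by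
    refine integral_congr_ae (.of_forall fun u => ?_)
    simp only [pow_zero, one_mul]
    rw [← Complex.exp_add]
    ring_nf
  rw [e, h, gaussianPDFReal]
  have h2 : (Real.pi / (1 / 2) : ℂ) ^ (1 / 2 : ℂ) = (Real.sqrt (2 * Real.pi) : ℝ) := by
    rw [Real.sqrt_eq_rpow, Complex.ofReal_cpow (by positivity)]
    push_cast
    ring_nf
  have h3 : 2 * Real.pi * (Real.sqrt (2 * Real.pi * (1 : NNReal)))⁻¹ = Real.sqrt (2 * Real.pi) := by
    rw [NNReal.coe_one, mul_one, ← div_eq_mul_inv, Real.div_sqrt]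
  rw [← mul_assoc, h3, h2, Complex.ofReal_mul, Complex.ofReal_exp]
  congr 2
  push_cast
  ring

lemma gaussianMoment_succ (j : ℕ) (x : ℝ) :
    gaussianMoment (j + 1) x = j * gaussianMoment (j - 1) x - I * x * gaussianMoment j x := by
  have hd : ∀ u : ℝ, HasDerivAt
      (fun u : ℝ => (u : ℂ) ^ j * Complex.exp (-(u : ℂ) ^ 2 / 2 - I * x * u))
      (j * ((u : ℂ) ^ (j - 1) * Complex.exp (-(u : ℂ) ^ 2 / 2 - I * x * u)) -
        I * x * ((u : ℂ) ^ j * Complex.exp (-(u : ℂ) ^ 2 / 2 - I * x * u)) -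
        (u : ℂ) ^ (j + 1) * Complex.exp (-(u : ℂ) ^ 2 / 2 - I * x * u)) u := by
    intro u
    have h0 : HasDerivAt (fun w : ℂ => w ^ j * Complex.exp (-w ^ 2 / 2 - I * x * w))
        (j * (u : ℂ) ^ (j - 1) * Complex.exp (-(u : ℂ) ^ 2 / 2 - I * x * u) + (u : ℂ) ^ j *
          (Complex.exp (-(u : ℂ) ^ 2 / 2 - I * x * u) * (-(2 * u) / 2 - I * x))) (u : ℂ) := by
      refine (hasDerivAt_pow j (u : ℂ)).mul (HasDerivAt.cexp ?_)
      simpa using ((hasDerivAt_pow 2 (u : ℂ)).fun_neg.div_const 2).fun_sub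
        ((hasDerivAt_id' (u : ℂ)).const_mul (I * x))
    convert h0.comp_ofReal using 1
    ring
  have i1 := integrable_gaussianMoment (j - 1) x
  have i2 := integrable_gaussianMoment j x
  have i3 := integrable_gaussianMoment (j + 1) x
  have h := integral_eq_zero_of_hasDerivAt_of_integrable hd
    (((i1.const_mul _).sub (i2.const_mul _)).sub i3) i2
  rw [integral_sub, integral_sub (i1.const_mul _) (i2.const_mul _), integral_const_mul,
    integral_const_mul] at h
  rotate_left
  · exact (i1.const_mul _).sub (i2.const_mul _)
  · exact i3
  simp only [gaussianMoment]
  linear_combination -h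

/-- The signed Edgeworth density. -/
noncomputable def edgeworthDensity (a x : ℝ) : ℝ :=
  gaussianPDFReal 0 1 x * (1 + a * (x ^ 3 - 3 * x))

lemma edgeworthTransform_mul_exp_eq (γ : ℝ) {n : ℕ} (hn : 0 < n) (u x : ℝ) :
    edgeworthTransform γ n (u / Real.sqrt n) * Complex.exp (-(I * x * u)) =
      2 * ((u : ℂ) ^ 0 * Complex.exp (-(u : ℂ) ^ 2 / 2 - I * x * u)) -
      (u : ℂ) ^ 2 * Complex.exp (-(u : ℂ) ^ 2 / 2 - I * x * u) -
      I * (γ / (6 * Real.sqrt n) : ℝ) *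
        (8 * ((u : ℂ) ^ 3 * Complex.exp (-(u : ℂ) ^ 2 / 2 - I * x * u)) -
        (u : ℂ) ^ 5 * Complex.exp (-(u : ℂ) ^ 2 / 2 - I * x * u) -
        6 * ((u : ℂ) ^ 1 * Complex.exp (-(u : ℂ) ^ 2 / 2 - I * x * u))) := by
  have hn0 : (0 : ℝ) < n := by exact_mod_cast hn
  have hr : (Real.sqrt n : ℂ) ≠ 0 := by exact_mod_cast (Real.sqrt_pos.2 hn0).ne'
  have hrn : (n : ℂ) = (Real.sqrt n : ℂ) ^ 2 := by
    rw [← Complex.ofReal_pow, Real.sq_sqrt hn0.le]; simp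
  have h1 : (n : ℝ) * (u / Real.sqrt n) ^ 2 = u ^ 2 := by
    rw [div_pow, Real.sq_sqrt hn0.le]; field_simp
  rw [edgeworthTransform, sub_eq_add_neg (-(u : ℂ) ^ 2 / 2), Complex.exp_add, h1]
  push_cast
  rw [hrn]
  field_simp
  ring

lemma integral_edgeworthTransform (γ : ℝ) {n : ℕ} (hn : 0 < n) (x : ℝ) :
    ∫ u : ℝ, edgeworthTransform γ n (u / Real.sqrt n) * Complex.exp (-(I * x * u)) =
      (2 * Real.pi * ((1 + x ^ 2) * edgeworthDensity (γ / (6 * Real.sqrt n)) x) : ℝ) := by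
  have i := integrable_gaussianMoment (x := x)
  have m := gaussianMoment_succ (x := x)
  simp_rw [edgeworthTransform_mul_exp_eq γ hn]
  rw [integral_sub, integral_sub ((i 0).const_mul _) (i 2), integral_const_mul,
    integral_const_mul, integral_sub, integral_sub ((i 3).const_mul _) (i 5), integral_const_mul,
    integral_const_mul]
  rotate_left
  · exact ((i 3).const_mul _).sub (i 5)
  · exact (i 1).const_mul _
  · exact ((i 0).const_mul _).sub (i 2)
  · exact ((((i 3).const_mul _).sub (i 5)).sub ((i 1).const_mul _)).const_mul _
  change 2 * gaussianMoment 0 x - gaussianMoment 2 x - _ * (8 * gaussianMoment 3 x -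
    gaussianMoment 5 x - 6 * gaussianMoment 1 x) = _
  have h1 : gaussianMoment 1 x = -(I * x * gaussianMoment 0 x) := by simpa using m 0
  have h2 : gaussianMoment 2 x = gaussianMoment 0 x - I * x * gaussianMoment 1 x := by
    simpa using m 1
  have h3 : gaussianMoment 3 x = 2 * gaussianMoment 1 x - I * x * gaussianMoment 2 x := by
    simpa using m 2
  have h4 : gaussianMoment 4 x = 3 * gaussianMoment 2 x - I * x * gaussianMoment 3 x := by
    simpa using m 3
  have h5 : gaussianMoment 5 x = 4 * gaussianMoment 3 x - I * x * gaussianMoment 4 x := by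
    simpa using m 4
  have hI4 : I ^ 4 = 1 := by rw [show 4 = 2 * 2 from rfl, pow_mul, Complex.I_sq]; norm_num
  have hI6 : I ^ 6 = -1 := by rw [show 6 = 2 * 3 from rfl, pow_mul, Complex.I_sq]; norm_num
  rw [h5, h4, h3, h2, h1, gaussianMoment_zero, edgeworthDensity]
  generalize γ / (6 * Real.sqrt n) = a
  push_cast
  ring_nf
  simp only [hI4, hI6, Complex.I_sq]
  ring

end gaussian

section lattice

lemma integral_cexp_lattice {δ : ℝ} (hδ : 0 < δ) (m : ℤ) :
    ∫ u in (-(Real.pi / δ))..(Real.pi / δ), Complex.exp ((u * (δ * m) : ℝ) * I) =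
      if m = 0 then ((2 * Real.pi / δ : ℝ) : ℂ) else 0 := by
  split_ifs with h
  · simp [h]
    ring
  · have hc : ((δ * m : ℝ) : ℂ) * I ≠ 0 := by
      simp [hδ.ne', h]
    have e : ∀ u : ℝ, Complex.exp ((u * (δ * m) : ℝ) * I) =
        Complex.exp (((δ * m : ℝ) : ℂ) * I * u) := by
      intro u; congr 1; push_cast; ring
    simp_rw [e]
    rw [integral_exp_mul_complex hc, div_eq_zero_iff]
    left
    rw [sub_eq_zero, Complex.exp_eq_exp_iff_exists_int]
    refine ⟨m, ?_⟩
    have : (δ : ℂ) ≠ 0 := by exact_mod_cast hδ.ne'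
    push_cast
    field_simp
    ring

lemma lattice_inversion {Ω : Type*} [MeasurableSpace Ω] {P : Measure Ω} [IsFiniteMeasure P]
    {S : Ω → ℤ} (hS : Measurable S) {f : Ω → ℂ} (hf : Integrable f P) {δ : ℝ} (hδ : 0 < δ) (k : ℤ) :
    ∫ u in (-(Real.pi / δ))..(Real.pi / δ),
        ∫ ω, f ω * Complex.exp ((u * (δ * (S ω - k : ℤ)) : ℝ) * I) ∂P =
      ((2 * Real.pi / δ : ℝ) : ℂ) * ∫ ω in {ω | S ω = k}, f ω ∂P := by
  have hle : -(Real.pi / δ) ≤ Real.pi / δ := by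
    have : 0 < Real.pi / δ := by positivity
    linarith
  have hmeas : Measurable fun ω => ((S ω - k : ℤ) : ℝ) :=
    (measurable_from_top (f := fun m : ℤ => ((m - k : ℤ) : ℝ))).comp hS
  have hm : MeasurableSet {ω | S ω = k} := hS (measurableSet_singleton k)
  rw [intervalIntegral.integral_of_le hle, integral_integral_swap]
  · have e : ∀ ω, ∫ u in Set.Ioc (-(Real.pi / δ)) (Real.pi / δ),
        f ω * Complex.exp ((u * (δ * (S ω - k : ℤ)) : ℝ) * I) =
        ({ω | S ω = k} : Set Ω).indicator (fun ω => ((2 * Real.pi / δ : ℝ) : ℂ) * f ω) ω := by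
      intro ω
      rw [← intervalIntegral.integral_of_le hle, intervalIntegral.integral_const_mul,
        integral_cexp_lattice hδ, Set.indicator_apply]
      simp only [Set.mem_ofPred_eq, sub_eq_zero]
      split_ifs <;> ring
    simp_rw [e]
    rw [integral_indicator hm, integral_const_mul]
  · have h1 : Integrable (fun p : ℝ × Ω => f p.2)
        ((volume.restrict (Set.Ioc (-(Real.pi / δ)) (Real.pi / δ))).prod P) := hf.comp_snd _
    refine h1.norm.mono' ?_ (.of_forall fun p => ?_)
    · refine h1.aestronglyMeasurable.mul (Measurable.aestronglyMeasurable ?_)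
      have : Measurable fun p : ℝ × Ω => ((S p.2 - k : ℤ) : ℝ) := hmeas.comp measurable_snd
      fun_prop
    · simp only [Function.uncurry, norm_mul]
      rw [Complex.norm_exp_ofReal_mul_I, mul_one]

end lattice

section pi

lemma sum_pow_zero_mul_cexp {α : Type*} {Y : α → ℝ} (n : ℕ) (s : ℝ) (ω : Fin n → α) :
    Complex.exp ((s * ∑ i, Y (ω i) : ℝ) * I) =
      ∏ l, ((Y (ω l) : ℂ) ^ 0 * Complex.exp ((s * Y (ω l) : ℝ) * I)) := by
  simp only [pow_zero, one_mul]
  rw [← Complex.exp_sum, Finset.mul_sum]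
  push_cast
  rw [Finset.sum_mul]

lemma sq_sum_mul_cexp {α : Type*} {Y : α → ℝ} (n : ℕ) (s : ℝ) (ω : Fin n → α) :
    ((∑ i, Y (ω i) : ℝ) : ℂ) ^ 2 * Complex.exp ((s * ∑ i, Y (ω i) : ℝ) * I) =
      ∑ i, ∑ j, ∏ l, ((Y (ω l) : ℂ) ^ ((if l = i then 1 else 0) + if l = j then 1 else 0) *
        Complex.exp ((s * Y (ω l) : ℝ) * I)) := by
  rw [sum_pow_zero_mul_cexp]
  simp only [Finset.prod_mul_distrib, pow_zero, one_mul, pow_add, pow_ite,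
    pow_one, Finset.prod_ite_eq', Finset.mem_univ, if_true]
  rw [pow_two]
  push_cast
  simp only [Finset.sum_mul, Finset.mul_sum]
  exact Finset.sum_congr rfl fun _ _ => Finset.sum_congr rfl fun _ _ => by ring

variable {α : Type*} [MeasurableSpace α] {μ : Measure α} [IsProbabilityMeasure μ] {Y : α → ℝ}

lemma integral_pi_cexp (n : ℕ) (s : ℝ) :
    ∫ ω, Complex.exp ((s * ∑ i, Y (ω i) : ℝ) * I) ∂(Measure.pi fun _ : Fin n => μ) =
      momentChar μ Y 0 s ^ n := by
  simp_rw [sum_pow_zero_mul_cexp]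
  rw [integral_fintype_prod_eq_pow (fun k => (Y k : ℂ) ^ 0 * Complex.exp ((s * Y k : ℝ) * I))]
  simp [momentChar]

lemma integrable_pi_sq_mul_cexp (hY : Measurable Y) (h4 : Integrable (fun k => Y k ^ 4) μ)
    (n : ℕ) (s : ℝ) (i j : Fin n) :
    Integrable (fun ω : Fin n → α => ∏ l, ((Y (ω l) : ℂ) ^ ((if l = i then 1 else 0) +
      if l = j then 1 else 0) * Complex.exp ((s * Y (ω l) : ℝ) * I)))
      (Measure.pi fun _ : Fin n => μ) :=
  Integrable.fintype_prod fun l => integrable_momentChar hY h4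
    (by split_ifs <;> norm_num) s

lemma integral_pi_sq_mul_cexp (hY : Measurable Y) (h4 : Integrable (fun k => Y k ^ 4) μ)
    (n : ℕ) (s : ℝ) :
    ∫ ω, ((∑ i, Y (ω i) : ℝ) : ℂ) ^ 2 * Complex.exp ((s * ∑ i, Y (ω i) : ℝ) * I)
        ∂(Measure.pi fun _ : Fin n => μ) =
      n * (momentChar μ Y 2 s * momentChar μ Y 0 s ^ (n - 1)) +
      n * (n - 1) * (momentChar μ Y 1 s ^ 2 * momentChar μ Y 0 s ^ (n - 2)) := by
  simp_rw [sq_sum_mul_cexp]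
  rw [integral_finsetSum _ fun i _ => integrable_finsetSum _ fun j _ =>
    integrable_pi_sq_mul_cexp hY h4 n s i j]
  set A := momentChar μ Y 2 s * momentChar μ Y 0 s ^ (n - 1) with hA
  set B := momentChar μ Y 1 s ^ 2 * momentChar μ Y 0 s ^ (n - 2) with hB
  have key : ∀ i j : Fin n, ∫ ω : Fin n → α, ∏ l, ((Y (ω l) : ℂ) ^ ((if l = i then 1 else 0) +
      if l = j then 1 else 0) * Complex.exp ((s * Y (ω l) : ℝ) * I))
      ∂(Measure.pi fun _ : Fin n => μ) = B + if i = j then A - B else 0 := by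
    intro i j
    rw [integral_fintype_prod_eq_prod (fun l k => (Y k : ℂ) ^ ((if l = i then 1 else 0) +
      if l = j then 1 else 0) * Complex.exp ((s * Y k : ℝ) * I))]
    change ∏ l, momentChar μ Y ((if l = i then 1 else 0) + if l = j then 1 else 0) s = _
    split_ifs with hij
    · subst hij
      rw [← Finset.mul_prod_erase _ _ (Finset.mem_univ i), Finset.prod_congr rfl
        (g := fun _ => momentChar μ Y 0 s) fun l hl => by simp [Finset.ne_of_mem_erase hl]]
      simp [hA]
    · rw [← Finset.mul_prod_erase _ _ (Finset.mem_univ i), ← Finset.mul_prod_erase _ _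
        (Finset.mem_erase.2 ⟨Ne.symm hij, Finset.mem_univ j⟩), Finset.prod_congr rfl
        (g := fun _ => momentChar μ Y 0 s) fun l hl => by
          have h1 := Finset.ne_of_mem_erase hl
          have h2 := Finset.ne_of_mem_erase (Finset.mem_of_mem_erase hl)
          simp [h1, h2]]
      rw [Finset.prod_const, Finset.card_erase_of_mem (Finset.mem_erase.2
        ⟨Ne.symm hij, Finset.mem_univ j⟩), Finset.card_erase_of_mem (Finset.mem_univ i),
        Finset.card_univ, Fintype.card_fin, Nat.sub_sub]
      simp [hij, Ne.symm hij, hB]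
      ring
  have key2 : ∀ i : Fin n, ∫ ω : Fin n → α, ∑ j, ∏ l, ((Y (ω l) : ℂ) ^ ((if l = i then 1 else 0) +
      if l = j then 1 else 0) * Complex.exp ((s * Y (ω l) : ℝ) * I))
      ∂(Measure.pi fun _ : Fin n => μ) = n * B + (A - B) := by
    intro i
    rw [integral_finsetSum _ fun j _ => integrable_pi_sq_mul_cexp hY h4 n s i j]
    simp_rw [key]
    simp [Finset.sum_add_distrib]
  simp_rw [key2]
  simp
  ring

lemma integrable_pi_sq (hY : Measurable Y) (h4 : Integrable (fun k => Y k ^ 4) μ) (n : ℕ) :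
    Integrable (fun ω : Fin n → α => ((∑ i, Y (ω i) : ℝ) : ℂ) ^ 2)
      (Measure.pi fun _ : Fin n => μ) := by
  have h := integrable_finsetSum Finset.univ fun i _ => integrable_finsetSum Finset.univ fun j _ =>
    integrable_pi_sq_mul_cexp hY h4 n 0 i j
  refine h.congr (.of_forall fun ω => ?_)
  have := sq_sum_mul_cexp (Y := Y) n 0 ω
  simp only [zero_mul, Complex.ofReal_zero, Complex.exp_zero, mul_one] at this ⊢
  exact this.symm

/-- The transform of `1 + W ^ 2` under the law of the normalized sum. -/
lemma integral_pi_eq_sumTransform (hY : Measurable Y) (h4 : Integrable (fun k => Y k ^ 4) μ)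
    {n : ℕ} (hn : 2 ≤ n) (u : ℝ) :
    ∫ ω, ((1 + ((∑ i, Y (ω i)) / Real.sqrt n) ^ 2 : ℝ) : ℂ) *
        Complex.exp ((u * ((∑ i, Y (ω i)) / Real.sqrt n) : ℝ) * I)
        ∂(Measure.pi fun _ : Fin n => μ) = sumTransform μ Y n (u / Real.sqrt n) := by
  have hn0 : (0 : ℝ) < n := by exact_mod_cast (by omega : 0 < n)
  have hnC : (n : ℂ) ≠ 0 := by exact_mod_cast hn0.ne'
  have hr : (Real.sqrt n : ℂ) ^ 2 = n := by
    rw [← Complex.ofReal_pow, Real.sq_sqrt hn0.le]; simp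
  set s := u / Real.sqrt n with hs
  have e : ∀ ω : Fin n → α, ((1 + ((∑ i, Y (ω i)) / Real.sqrt n) ^ 2 : ℝ) : ℂ) *
        Complex.exp ((u * ((∑ i, Y (ω i)) / Real.sqrt n) : ℝ) * I) =
      Complex.exp ((s * ∑ i, Y (ω i) : ℝ) * I) + (n : ℂ)⁻¹ * (((∑ i, Y (ω i) : ℝ) : ℂ) ^ 2 *
        Complex.exp ((s * ∑ i, Y (ω i) : ℝ) * I)) := by
    intro ω
    have h1 : u * ((∑ i, Y (ω i)) / Real.sqrt n) = s * ∑ i, Y (ω i) := by rw [hs]; ring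
    rw [h1, Complex.ofReal_add, Complex.ofReal_pow, Complex.ofReal_div, div_pow, hr]
    push_cast
    ring
  simp_rw [e]
  rw [integral_add, integral_const_mul, integral_pi_cexp, integral_pi_sq_mul_cexp hY h4,
    sumTransform]
  · obtain ⟨m, rfl⟩ : ∃ m, n = m + 2 := ⟨n - 2, by omega⟩
    simp only [Nat.add_sub_cancel, show m + 2 - 1 = m + 1 by omega]
    field_simp
    ring
  · simp_rw [sum_pow_zero_mul_cexp]
    exact Integrable.fintype_prod fun l => integrable_momentChar hY h4 (by norm_num) s
  · refine Integrable.const_mul ?_ _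
    simp_rw [sq_sum_mul_cexp]
    exact integrable_finsetSum _ fun i _ => integrable_finsetSum _ fun j _ =>
      integrable_pi_sq_mul_cexp hY h4 n s i j

end pi

section span

lemma exists_cexp_eq_of_one_le_norm {α : Type*} [MeasurableSpace α] {μ : Measure α}
    [IsProbabilityMeasure μ] {f : α → ℂ} (hf : Measurable f) (h1 : ∀ k, ‖f k‖ = 1)
    (h : 1 ≤ ‖∫ k, f k ∂μ‖) : ∃ w : ℂ, ∀ᵐ k ∂μ, f k = w := by
  set v := ∫ k, f k ∂μ with hv
  have hi : Integrable f μ := Integrable.of_bound hf.aestronglyMeasurable 1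
    (.of_forall fun k => (h1 k).le)
  have hle : ‖v‖ ≤ 1 := by
    have := norm_integral_le_of_norm_le_const (μ := μ) (f := f) (C := 1)
      (.of_forall fun k => (h1 k).le)
    simpa using this
  have hn : ‖v‖ = 1 := le_antisymm hle h
  refine ⟨v, ?_⟩
  have hi2 : Integrable (fun k => ‖f k - v‖ ^ 2) μ := by
    refine Integrable.of_bound (by fun_prop) 4 (.of_forall fun k => ?_)
    have := norm_sub_le (f k) v
    rw [h1, hn] at this
    rw [norm_pow, norm_norm]
    nlinarith [norm_nonneg (f k - v)]
  have e : ∀ k, ‖f k - v‖ ^ 2 = 2 - 2 * (f k * (starRingEnd ℂ) v).re := by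
    intro k
    rw [← Complex.normSq_eq_norm_sq, Complex.normSq_sub, Complex.normSq_eq_norm_sq,
      Complex.normSq_eq_norm_sq, h1, hn]
    ring
  have h0 : ∫ k, ‖f k - v‖ ^ 2 ∂μ = 0 := by
    simp_rw [e]
    have hre : ∫ k, (f k * (starRingEnd ℂ) v).re ∂μ = 1 := by
      have := integral_re (𝕜 := ℂ) (hi.mul_const ((starRingEnd ℂ) v))
      simp only [RCLike.re_eq_complex_re] at this
      rw [this, integral_mul_const, ← hv, Complex.mul_conj, Complex.normSq_eq_norm_sq, hn]
      simp
    have hrei : Integrable (fun k => (f k * (starRingEnd ℂ) v).re) μ :=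
      (hi.mul_const ((starRingEnd ℂ) v)).re
    rw [integral_sub (integrable_const _) (hrei.const_mul 2), integral_const_mul, hre]
    simp
  rw [integral_eq_zero_iff_of_nonneg (fun k => by positivity) hi2] at h0
  filter_upwards [h0] with k hk
  have : ‖f k - v‖ = 0 := by simpa using hk
  exact sub_eq_zero.1 (norm_eq_zero.1 this)

variable {μ : Measure ℤ} [IsProbabilityMeasure μ]

/-- The characteristic function of a lattice law of span one has modulus `1` only at `0`
within one period. -/
lemma norm_momentChar_lt_one {μ₀ σ : ℝ} (hσ : 0 < σ) {s₀ : ℤ} (hs₀ : μ {s₀} ≠ 0)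
    (hgcd : ∀ d : ℕ, (∀ s : ℤ, μ {s} ≠ 0 → (d : ℤ) ∣ (s - s₀)) → d = 1)
    {s : ℝ} (hs : s ≠ 0) (hle : |s| ≤ Real.pi * σ) :
    ‖momentChar μ (fun k : ℤ => ((k : ℝ) - μ₀) / σ) 0 s‖ < 1 := by
  by_contra! hcon
  simp only [momentChar, pow_zero, one_mul] at hcon
  obtain ⟨w, hw⟩ := exists_cexp_eq_of_one_le_norm (measurable_of_countable _)
    (fun k => Complex.norm_exp_ofReal_mul_I _) hcon
  have hw' : ∀ k, μ {k} ≠ 0 →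
      Complex.exp ((s * (((k : ℝ) - μ₀) / σ) : ℝ) * I) = w := by
    intro k hk
    by_contra hne
    exact hk (measure_mono_null (fun x hx => by rw [Set.mem_singleton_iff.1 hx]; exact hne)
      (ae_iff.1 hw))
  set t := s / σ with ht
  let φ : ℤ → ℂ := fun m => Complex.exp ((t * m : ℝ) * I)
  let H : AddSubgroup ℤ :=
    { carrier := {m | φ m = 1}
      zero_mem' := by simp [φ]
      add_mem' := by
        intro a b ha hb
        have : φ (a + b) = φ a * φ b := by
          simp only [φ]
          rw [← Complex.exp_add]
          push_cast
          ring_nf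
        change φ (a + b) = 1
        rw [this, show φ a = 1 from ha, show φ b = 1 from hb, one_mul]
      neg_mem' := by
        intro a ha
        have : φ (-a) = (φ a)⁻¹ := by
          simp only [φ]
          rw [← Complex.exp_neg]
          push_cast
          ring_nf
        change φ (-a) = 1
        rw [this, show φ a = 1 from ha, inv_one] }
  have hH : ∀ k, μ {k} ≠ 0 → k - s₀ ∈ H := by
    intro k hk
    have h1 := hw' k hk
    have h2 := hw' s₀ hs₀
    change φ (k - s₀) = 1
    have : φ (k - s₀) * Complex.exp ((s * (((s₀ : ℝ) - μ₀) / σ) : ℝ) * I) =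
        Complex.exp ((s * (((k : ℝ) - μ₀) / σ) : ℝ) * I) := by
      simp only [φ, ht]
      rw [← Complex.exp_add]
      push_cast
      ring_nf
    rw [h1, h2] at this
    have hw0 : w ≠ 0 := by rw [← h2]; exact Complex.exp_ne_zero _
    exact mul_right_cancel₀ hw0 (by rw [this, one_mul])
  obtain ⟨d, hd⟩ := Int.subgroup_cyclic H
  have hdm : ∀ m ∈ H, d ∣ m := fun m hm => by
    rw [hd] at hm
    obtain ⟨c, rfl⟩ := AddSubgroup.mem_closure_singleton.1 hm
    simp
  have hd1 := hgcd d.natAbs fun k hk => Int.natAbs_dvd.2 (hdm _ (hH k hk))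
  have hone : (1 : ℤ) ∈ H := by
    have hdH : d ∈ H := by rw [hd]; exact AddSubgroup.subset_closure rfl
    rcases Int.natAbs_eq d with h | h
    · rw [h, hd1] at hdH; simpa using hdH
    · rw [h, hd1] at hdH; simpa using H.neg_mem hdH
  have hφ1 : Complex.exp ((t * (1 : ℤ) : ℝ) * I) = 1 := hone
  have ht0 : t ≠ 0 := div_ne_zero hs hσ.ne'
  have htp : |t| ≤ Real.pi := by
    rw [ht, abs_div, abs_of_pos hσ, div_le_iff₀ hσ]
    exact hle
  rw [Complex.exp_eq_one_iff] at hφ1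
  obtain ⟨m, hm⟩ := hφ1
  have hm' : t = m * (2 * Real.pi) := by
    have := congrArg Complex.im hm
    simpa using this
  have hm0 : m ≠ 0 := by
    rintro rfl
    exact ht0 (by simpa using hm')
  have : (1 : ℝ) ≤ |(m : ℝ)| := by
    rw [← Int.cast_abs]; exact_mod_cast Int.one_le_abs hm0
  rw [hm', abs_mul, abs_of_pos (by positivity : 0 < 2 * Real.pi)] at htp
  nlinarith [Real.pi_pos]

end span

section local_bound

lemma integrable_one_add_sq_pow_mul_exp {c : ℝ} (hc : 0 < c) (j : ℕ) :
    Integrable fun u : ℝ => (1 + u ^ 2) ^ j * Real.exp (-c * u ^ 2) := by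
  have e : (fun u : ℝ => (1 + u ^ 2) ^ j * Real.exp (-c * u ^ 2)) = fun u =>
      ∑ m ∈ Finset.range (j + 1), (j.choose m : ℝ) * (u ^ (2 * m) * Real.exp (-c * u ^ 2)) := by
    funext u
    rw [add_comm, add_pow, Finset.sum_mul]
    refine Finset.sum_congr rfl fun m _ => ?_
    rw [one_pow, mul_one, ← pow_mul]
    ring
  rw [e]
  exact integrable_finsetSum _ fun m _ => (integrable_pow_mul_exp_neg_mul_sq hc _).const_mul _

lemma integrable_edgeworthTransform (γ : ℝ) {n : ℕ} (hn : 0 < n) (x : ℝ) :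
    Integrable fun u : ℝ =>
      edgeworthTransform γ n (u / Real.sqrt n) * Complex.exp (-(I * x * u)) := by
  have i := integrable_gaussianMoment (x := x)
  simp_rw [edgeworthTransform_mul_exp_eq γ hn]
  exact (((i 0).const_mul _).sub (i 2)).sub
    (((((i 3).const_mul _).sub (i 5)).sub ((i 1).const_mul _)).const_mul _)

lemma continuous_sumTransform {α : Type*} [MeasurableSpace α] {μ : Measure α}
    [IsProbabilityMeasure μ] {Y : α → ℝ} (hY : Measurable Y)
    (h4 : Integrable (fun k => Y k ^ 4) μ) (n : ℕ) : Continuous (sumTransform μ Y n) := by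
  have h0 := continuous_momentChar (μ := μ) hY (integrable_pow_of_pow_four hY h4 (j := 0) (by norm_num))
  have h1 := continuous_momentChar (μ := μ) hY (integrable_pow_of_pow_four hY h4 (j := 1) (by norm_num))
  have h2 := continuous_momentChar (μ := μ) hY (integrable_pow_of_pow_four hY h4 (j := 2) (by norm_num))
  unfold sumTransform
  fun_prop

variable {μ : Measure ℤ} [IsProbabilityMeasure μ] {μ₀ σ : ℝ}

lemma integral_sumTransform_eq_measureReal (hσ : 0 < σ)
    (h4 : Integrable (fun k : ℤ => (((k : ℝ) - μ₀) / σ) ^ 4) μ) {n : ℕ} (hn : 2 ≤ n) {δ : ℝ}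
    (hδ : δ = 1 / (σ * Real.sqrt n)) (k : ℤ) :
    ∫ u in (-(Real.pi / δ))..(Real.pi / δ),
        sumTransform μ (fun k : ℤ => ((k : ℝ) - μ₀) / σ) n (u / Real.sqrt n) *
          Complex.exp (-(I * (δ * (k - n * μ₀) : ℝ) * u)) =
      (2 * Real.pi / δ * ((1 + (δ * (k - n * μ₀)) ^ 2) *
        (Measure.pi fun _ : Fin n => μ).real {ω | ∑ i, ω i = k}) : ℝ) := by
  set Y : ℤ → ℝ := fun k => ((k : ℝ) - μ₀) / σ with hYdef
  have hY : Measurable Y := measurable_of_countable _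
  have hn0 : (0 : ℝ) < n := by exact_mod_cast (by omega : 0 < n)
  have hsn := Real.sqrt_pos.2 hn0
  have hδ0 : 0 < δ := by rw [hδ]; positivity
  set P := Measure.pi fun _ : Fin n => μ with hP
  have hW : ∀ ω : Fin n → ℤ, (∑ i, Y (ω i)) / Real.sqrt n = δ * ((∑ i, ω i : ℤ) - n * μ₀) := by
    intro ω
    simp only [hYdef]
    rw [← Finset.sum_div, Finset.sum_sub_distrib, hδ]
    push_cast
    simp
    field_simp
  have hS : Measurable fun ω : Fin n → ℤ => ∑ i, ω i :=
    Finset.measurable_sum _ fun i _ => measurable_pi_apply i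
  have hf : Integrable (fun ω : Fin n → ℤ =>
      ((1 + ((∑ i, Y (ω i)) / Real.sqrt n) ^ 2 : ℝ) : ℂ)) P := by
    have := (integrable_const (1 : ℂ)).add ((integrable_pi_sq hY h4 n).div_const ((Real.sqrt n : ℂ) ^ 2))
    refine this.congr (.of_forall fun ω => ?_)
    have hr : (Real.sqrt n : ℂ) ^ 2 = n := by
      rw [← Complex.ofReal_pow, Real.sq_sqrt hn0.le]; simp
    simp [div_pow, hr]
  have key := lattice_inversion hS hf hδ0 k
  have hm : MeasurableSet {ω : Fin n → ℤ | ∑ i, ω i = k} := hS (measurableSet_singleton k)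
  have hR : ∫ ω in {ω : Fin n → ℤ | ∑ i, ω i = k},
      ((1 + ((∑ i, Y (ω i)) / Real.sqrt n) ^ 2 : ℝ) : ℂ) ∂P =
      (((1 + (δ * (k - n * μ₀)) ^ 2) * P.real {ω | ∑ i, ω i = k} : ℝ) : ℂ) := by
    rw [setIntegral_congr_fun (g := fun _ => ((1 + (δ * (k - n * μ₀)) ^ 2 : ℝ) : ℂ)) hm
      fun ω hω => ?_]
    · rw [setIntegral_const, Complex.real_smul]
      push_cast
      ring
    · have : ∑ i, ω i = k := hω
      simp only [hW, this]
  rw [hR] at key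
  refine Eq.trans ?_ (key.trans (Complex.ofReal_mul _ _).symm)
  refine intervalIntegral.integral_congr fun u _ => ?_
  rw [← integral_pi_eq_sumTransform hY h4 hn, ← integral_mul_const]
  refine integral_congr_ae (.of_forall fun ω => ?_)
  simp only
  rw [mul_assoc, ← Complex.exp_add]
  congr 2
  rw [hW]
  push_cast
  ring

lemma exists_local_bound {γ : ℝ} (hσ : 0 < σ)
    (h4 : Integrable (fun k : ℤ => (((k : ℝ) - μ₀) / σ) ^ 4) μ)
    (hY1 : ∫ k : ℤ, ((k : ℝ) - μ₀) / σ ∂μ = 0) (hY2 : ∫ k : ℤ, (((k : ℝ) - μ₀) / σ) ^ 2 ∂μ = 1)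
    (hY3 : ∫ k : ℤ, (((k : ℝ) - μ₀) / σ) ^ 3 ∂μ = γ)
    (hlt : ∀ s : ℝ, s ≠ 0 → |s| ≤ Real.pi * σ →
      ‖momentChar μ (fun k : ℤ => ((k : ℝ) - μ₀) / σ) 0 s‖ < 1) :
    ∃ C : ℝ, 0 ≤ C ∧ ∀ n : ℕ, 2 ≤ n → ∀ δ : ℝ, δ = 1 / (σ * Real.sqrt n) → ∀ k : ℤ,
      (1 + (δ * (k - n * μ₀)) ^ 2) *
        |(Measure.pi fun _ : Fin n => μ).real {ω | ∑ i, ω i = k} -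
          δ * edgeworthDensity (γ / (6 * Real.sqrt n)) (δ * (k - n * μ₀))| ≤ C * δ ^ 3 := by
  have hY : Measurable fun k : ℤ => ((k : ℝ) - μ₀) / σ := measurable_of_countable _
  obtain ⟨C, c, hC, hc, hB⟩ := exists_sumTransform_bound hY h4 hY1 hY2 hY3
    (mul_pos Real.pi_pos hσ) hlt
  set J := ∫ u : ℝ, (1 + u ^ 2) ^ 4 * Real.exp (-c * u ^ 2) with hJ
  have hJ0 : 0 ≤ J := integral_nonneg fun u => by positivity
  refine ⟨C * σ ^ 2 * J / (2 * Real.pi), by positivity, fun n hn δ hδ k => ?_⟩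
  have hn0 : (0 : ℝ) < n := by exact_mod_cast (by omega : 0 < n)
  have hsn := Real.sqrt_pos.2 hn0
  have hδ0 : 0 < δ := by rw [hδ]; positivity
  obtain ⟨hB1, hB2⟩ := hB n hn
  set z := δ * (k - n * μ₀) with hz
  set S := sumTransform μ (fun k : ℤ => ((k : ℝ) - μ₀) / σ) n with hSdef
  set p := (Measure.pi fun _ : Fin n => μ).real {ω | ∑ i, ω i = k} with hp
  set g := edgeworthDensity (γ / (6 * Real.sqrt n)) z with hg
  have hSc : Continuous S := continuous_sumTransform hY h4 n
  have hπδ : 0 < Real.pi / δ := div_pos Real.pi_pos hδ0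
  have hle : -(Real.pi / δ) ≤ Real.pi / δ := by linarith
  have h1 := integral_sumTransform_eq_measureReal hσ h4 hn hδ k
  have h2 := integral_edgeworthTransform γ (by omega : 0 < n) z
  rw [intervalIntegral.integral_of_le hle, ← integral_indicator measurableSet_Ioc] at h1
  have i1 : Integrable ((Set.Ioc (-(Real.pi / δ)) (Real.pi / δ)).indicator fun u : ℝ =>
      S (u / Real.sqrt n) * Complex.exp (-(I * z * u))) := by
    rw [integrable_indicator_iff measurableSet_Ioc]
    refine (Continuous.integrableOn_Icc ?_).mono_set Set.Ioc_subset_Icc_self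
    fun_prop
  have i2 := integrable_edgeworthTransform γ (by omega : 0 < n) z
  have h3 := integral_sub i1 i2
  rw [h1, h2] at h3
  have hsq : ∀ u : ℝ, n * (u / Real.sqrt n) ^ 2 = u ^ 2 := fun u => by
    rw [div_pow, Real.sq_sqrt hn0.le]; field_simp
  have hiff : Real.pi / δ = Real.pi * σ * Real.sqrt n := by rw [hδ]; field_simp
  have hbound : ‖∫ u, ((Set.Ioc (-(Real.pi / δ)) (Real.pi / δ)).indicator (fun u : ℝ =>
      S (u / Real.sqrt n) * Complex.exp (-(I * z * u))) u -
      edgeworthTransform γ n (u / Real.sqrt n) * Complex.exp (-(I * z * u)))‖ ≤ C / n * J := by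
    rw [hJ, ← integral_const_mul]
    refine norm_integral_le_of_norm_le ((integrable_one_add_sq_pow_mul_exp hc 4).const_mul _)
      (.of_forall fun u => ?_)
    have hexp : ‖Complex.exp (-(I * z * u))‖ = 1 := by
      have : -(I * z * u) = ((-(z * u) : ℝ) : ℂ) * I := by push_cast; ring
      rw [this, Complex.norm_exp_ofReal_mul_I]
    have habs : |u / Real.sqrt n| = |u| / Real.sqrt n := by rw [abs_div, abs_of_pos hsn]
    by_cases hu : u ∈ Set.Ioc (-(Real.pi / δ)) (Real.pi / δ)
    · rw [Set.indicator_of_mem hu, ← sub_mul, norm_mul, hexp, mul_one]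
      have := hB1 (u / Real.sqrt n) (by
        rw [habs, div_le_iff₀ hsn, ← hiff]
        exact abs_le.2 ⟨hu.1.le, hu.2⟩)
      rwa [hsq, mul_assoc] at this
    · rw [Set.indicator_of_notMem hu, zero_sub, norm_neg, norm_mul, hexp, mul_one]
      have := hB2 (u / Real.sqrt n) (by
        rw [habs, le_div_iff₀ hsn, ← hiff]
        by_contra! hlt
        exact hu ⟨(abs_lt.1 hlt).1, (abs_lt.1 hlt).2.le⟩)
      rwa [hsq, mul_assoc] at this
  simp only [← hz, ← hp] at h3
  rw [h3, ← Complex.ofReal_sub, Complex.norm_real, Real.norm_eq_abs] at hbound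
  have e : 2 * Real.pi / δ * ((1 + z ^ 2) * p) - 2 * Real.pi * ((1 + z ^ 2) * g) =
      2 * Real.pi / δ * ((1 + z ^ 2) * (p - δ * g)) := by field_simp
  rw [e, abs_mul, abs_mul, abs_of_pos (by positivity : 0 < 2 * Real.pi / δ),
    abs_of_pos (by positivity : 0 < 1 + z ^ 2)] at hbound
  have hnδ : (1 : ℝ) / n = σ ^ 2 * δ ^ 2 := by
    rw [hδ, div_pow, mul_pow, Real.sq_sqrt hn0.le]; field_simp
  rw [div_eq_mul_one_div C, hnδ] at hbound
  have hpos := Real.pi_pos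
  rw [div_mul_eq_mul_div, div_le_iff₀ hδ0] at hbound
  rw [div_mul_eq_mul_div, le_div_iff₀ (by positivity)]
  calc _ = 2 * Real.pi * ((1 + z ^ 2) * |p - δ * g|) := by ring
    _ ≤ _ := hbound
    _ = _ := by ring

end local_bound

section density

lemma gaussianPDFReal_zero_one (x : ℝ) :
    gaussianPDFReal 0 1 x = (Real.sqrt (2 * Real.pi))⁻¹ * Real.exp (-(1 / 2) * x ^ 2) := by
  rw [gaussianPDFReal, NNReal.coe_one, mul_one, mul_one, sub_zero]
  congr 2
  ring

lemma integrable_gaussianPDFReal_mul_pow (j : ℕ) :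
    Integrable fun x : ℝ => gaussianPDFReal 0 1 x * x ^ j := by
  simp_rw [gaussianPDFReal_zero_one]
  refine ((integrable_pow_mul_exp_neg_mul_sq (show (0 : ℝ) < 1 / 2 by norm_num) j).const_mul
    (Real.sqrt (2 * Real.pi))⁻¹).congr (.of_forall fun x => ?_)
  simp only
  ring

lemma integrable_gaussianPDFReal_mul_hermite :
    Integrable fun x : ℝ => gaussianPDFReal 0 1 x * (x ^ 3 - 3 * x) := by
  refine ((integrable_gaussianPDFReal_mul_pow 3).sub
    ((integrable_gaussianPDFReal_mul_pow 1).const_mul 3)).congr (.of_forall fun x => ?_)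
  simp only [Pi.sub_apply]
  ring

lemma integrable_gaussianPDFReal_mul_hermite_sq :
    Integrable fun x : ℝ => gaussianPDFReal 0 1 x * (x ^ 3 - 3 * x) ^ 2 := by
  refine (((integrable_gaussianPDFReal_mul_pow 6).sub
    ((integrable_gaussianPDFReal_mul_pow 4).const_mul 6)).add
    ((integrable_gaussianPDFReal_mul_pow 2).const_mul 9)).congr (.of_forall fun x => ?_)
  simp only [Pi.sub_apply, Pi.add_apply]
  ring

lemma integrable_edgeworthDensity (a : ℝ) : Integrable (edgeworthDensity a) := by
  refine ((integrable_gaussianPDFReal 0 1).add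
    (integrable_gaussianPDFReal_mul_hermite.const_mul a)).congr (.of_forall fun x => ?_)
  simp only [Pi.add_apply, edgeworthDensity]
  ring

lemma abs_edgeworthDensity_le (a x : ℝ) :
    |edgeworthDensity a x| ≤
      edgeworthDensity a x + 2 * a ^ 2 * (gaussianPDFReal 0 1 x * (x ^ 3 - 3 * x) ^ 2) := by
  have h0 := gaussianPDFReal_nonneg 0 1 x
  set y := a * (x ^ 3 - 3 * x) with hy
  have h1 : |1 + y| ≤ 1 + y + 2 * y ^ 2 := by
    rw [abs_le]
    constructor <;> nlinarith [sq_nonneg y, sq_nonneg (2 * y + 1)]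
  rw [edgeworthDensity, ← hy, abs_mul, abs_of_nonneg h0]
  refine (mul_le_mul_of_nonneg_left h1 h0).trans_eq ?_
  rw [hy]
  ring

lemma hasDerivAt_gaussianPDFReal_mul {q : ℝ → ℝ} {q' x : ℝ} (hq : HasDerivAt q q' x) :
    HasDerivAt (fun x => gaussianPDFReal 0 1 x * q x)
      (gaussianPDFReal 0 1 x * (q' - x * q x)) x := by
  simp_rw [gaussianPDFReal_zero_one]
  have h1 : HasDerivAt (fun x : ℝ => -(1 / 2) * x ^ 2) (-x) x := by
    have := (hasDerivAt_pow 2 x).const_mul (-(1 / 2) : ℝ)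
    refine this.congr_deriv ?_
    push_cast
    ring
  refine ((h1.exp.const_mul (Real.sqrt (2 * Real.pi))⁻¹).mul hq).congr_deriv ?_
  ring

lemma hasDerivAt_edgeworthDensity (a x : ℝ) :
    HasDerivAt (edgeworthDensity a)
      (gaussianPDFReal 0 1 x * (-x - a * (x ^ 4 - 6 * x ^ 2 + 3))) x := by
  have h : HasDerivAt (fun x : ℝ => 1 + a * (x ^ 3 - 3 * x)) (a * (3 * x ^ 2 - 3)) x := by
    have := (((hasDerivAt_pow 3 x).sub ((hasDerivAt_id' x).const_mul 3)).const_mul a).const_add 1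
    refine this.congr_deriv ?_
    norm_num
  refine (hasDerivAt_gaussianPDFReal_mul h).congr_deriv ?_
  ring

lemma hasDerivAt_deriv_edgeworthDensity (a x : ℝ) :
    HasDerivAt (fun x => gaussianPDFReal 0 1 x * (-x - a * (x ^ 4 - 6 * x ^ 2 + 3)))
      (gaussianPDFReal 0 1 x * (x ^ 2 - 1 + a * (x ^ 5 - 10 * x ^ 3 + 15 * x))) x := by
  have h : HasDerivAt (fun x : ℝ => -x - a * (x ^ 4 - 6 * x ^ 2 + 3))
      (-1 - a * (4 * x ^ 3 - 12 * x)) x := by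
    have := (hasDerivAt_id' x).neg.sub ((((hasDerivAt_pow 4 x).sub
      ((hasDerivAt_pow 2 x).const_mul 6)).add_const 3).const_mul a)
    refine this.congr_deriv ?_
    push_cast
    ring
  refine (hasDerivAt_gaussianPDFReal_mul h).congr_deriv ?_
  ring

lemma one_add_sq_mul_abs_deriv_deriv_edgeworthDensity_le {a A : ℝ} (ha : |a| ≤ A) (x : ℝ) :
    (1 + x ^ 2) *
      |gaussianPDFReal 0 1 x * (x ^ 2 - 1 + a * (x ^ 5 - 10 * x ^ 3 + 15 * x))| ≤
      (1 + 26 * A) * 768 := by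
  have hA : 0 ≤ A := (abs_nonneg a).trans ha
  have hpos := Real.pi_gt_three
  have h1 : gaussianPDFReal 0 1 x ≤ Real.exp (-(1 / 2) * x ^ 2) := by
    rw [gaussianPDFReal_zero_one]
    refine mul_le_of_le_one_left (Real.exp_pos _).le (inv_le_one_of_one_le₀ ?_)
    rw [Real.one_le_sqrt]
    linarith
  have h2 : (1 + x ^ 2) ^ 4 * Real.exp (-(1 / 2) * x ^ 2) ≤ 768 := by
    have h3 := Real.pow_div_factorial_le_exp (x := (1 + x ^ 2) / 2) (by positivity) 4
    have h4 : (1 + x ^ 2) ^ 4 ≤ 384 * Real.exp ((1 + x ^ 2) / 2) := by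
      rw [div_pow] at h3
      norm_num [Nat.factorial] at h3
      linarith
    have h5 : Real.exp (1 / 2) ≤ 2 := by
      have := Real.exp_bound_div_one_sub_of_interval (x := 1 / 2) (by norm_num) (by norm_num)
      norm_num at this ⊢
      exact this
    calc _ ≤ 384 * Real.exp ((1 + x ^ 2) / 2) * Real.exp (-(1 / 2) * x ^ 2) := by gcongr
      _ = 384 * Real.exp (1 / 2) := by
        rw [mul_assoc, ← Real.exp_add]
        ring_nf
      _ ≤ _ := by linarith
  have h6 : |x ^ 5 - 10 * x ^ 3 + 15 * x| ≤ 26 * (1 + x ^ 2) ^ 3 := by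
    have hx : |x| ≤ 1 + x ^ 2 := by
      rw [← sq_abs]; nlinarith [sq_nonneg (|x| - 1), abs_nonneg x]
    have e : x ^ 5 - 10 * x ^ 3 + 15 * x = x * (x ^ 4 - 10 * x ^ 2 + 15) := by ring
    have hq : |x ^ 4 - 10 * x ^ 2 + 15| ≤ 26 * (1 + x ^ 2) ^ 2 := by
      rw [abs_le]
      constructor <;> nlinarith [sq_nonneg x, sq_nonneg (x ^ 2)]
    rw [e, abs_mul]
    calc _ ≤ (1 + x ^ 2) * (26 * (1 + x ^ 2) ^ 2) := by gcongr
      _ = _ := by ring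
  have h7 : |x ^ 2 - 1 + a * (x ^ 5 - 10 * x ^ 3 + 15 * x)| ≤ (1 + 26 * A) * (1 + x ^ 2) ^ 3 := by
    have h8 : |x ^ 2 - 1| ≤ (1 + x ^ 2) ^ 3 := by
      rw [abs_le]
      constructor <;> nlinarith [sq_nonneg x, sq_nonneg (x ^ 2), pow_nonneg (sq_nonneg x) 3]
    refine (abs_add_le _ _).trans ?_
    rw [abs_mul]
    calc _ ≤ (1 + x ^ 2) ^ 3 + A * (26 * (1 + x ^ 2) ^ 3) := by gcongr
      _ = _ := by ring
  rw [abs_mul, abs_of_nonneg (gaussianPDFReal_nonneg 0 1 x)]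
  calc _ ≤ (1 + x ^ 2) * (Real.exp (-(1 / 2) * x ^ 2) * ((1 + 26 * A) * (1 + x ^ 2) ^ 3)) := by
        gcongr
    _ = (1 + 26 * A) * ((1 + x ^ 2) ^ 4 * Real.exp (-(1 / 2) * x ^ 2)) := by ring
    _ ≤ _ := by gcongr

lemma one_add_sq_le_of_mem_cell {δ z x : ℝ} (hx : |x - z| ≤ δ / 2) :
    1 + z ^ 2 ≤ (2 + δ ^ 2 / 2) * (1 + x ^ 2) := by
  have h1 : (x - z) ^ 2 ≤ (δ / 2) ^ 2 := sq_le_sq' (abs_le.1 hx).1 (abs_le.1 hx).2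
  nlinarith [sq_nonneg (x + (x - z)), sq_nonneg x, mul_nonneg (sq_nonneg δ) (sq_nonneg x)]

/-- The midpoint rule for a function with bounded second derivative. -/
lemma abs_integral_sub_midpoint_le {g g' g'' : ℝ → ℝ} {z δ M : ℝ} (hδ : 0 < δ)
    (hg : ∀ x, HasDerivAt g (g' x) x) (hg' : ∀ x, HasDerivAt g' (g'' x) x)
    (hM : ∀ x, |x - z| ≤ δ / 2 → |g'' x| ≤ M) :
    |(∫ x in Set.Ioc (z - δ / 2) (z + δ / 2), g x) - δ * g z| ≤ M * δ ^ 3 := by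
  have hmem : ∀ x ∈ Set.Icc (z - δ / 2) (z + δ / 2), |x - z| ≤ δ / 2 := fun x hx => by
    rw [abs_le]; constructor <;> linarith [hx.1, hx.2]
  have hz : z ∈ Set.Icc (z - δ / 2) (z + δ / 2) := ⟨by linarith, by linarith⟩
  have hM0 : 0 ≤ M := (abs_nonneg _).trans (hM z (hmem z hz))
  have hc : Convex ℝ (Set.Icc (z - δ / 2) (z + δ / 2)) := convex_Icc _ _
  have h1 : ∀ x ∈ Set.Icc (z - δ / 2) (z + δ / 2), ‖g' x - g' z‖ ≤ M * δ := fun x hx => by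
    have := hc.norm_image_sub_le_of_norm_hasDerivWithin_le
      (fun y _ => (hg' y).hasDerivWithinAt) (fun y hy => hM y (hmem y hy)) hz hx
    refine this.trans ?_
    rw [Real.norm_eq_abs]
    gcongr
    linarith [hmem x hx]
  have h2 : ∀ x ∈ Set.Icc (z - δ / 2) (z + δ / 2),
      ‖(g x - g' z * x) - (g z - g' z * z)‖ ≤ M * δ * δ := fun x hx => by
    have := hc.norm_image_sub_le_of_norm_hasDerivWithin_le (f := fun x => g x - g' z * x)
      (f' := fun x => g' x - g' z)
      (fun y _ => by
        simpa using ((hg y).fun_sub ((hasDerivAt_id' y).const_mul (g' z))).hasDerivWithinAt)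
      h1 hz hx
    refine this.trans ?_
    rw [Real.norm_eq_abs]
    gcongr
    linarith [hmem x hx]
  have hle : z - δ / 2 ≤ z + δ / 2 := by linarith
  have hcont : Continuous g := continuous_iff_continuousAt.2 fun x => (hg x).continuousAt
  rw [← intervalIntegral.integral_of_le hle]
  have e : (∫ x in (z - δ / 2)..(z + δ / 2), g x) - δ * g z =
      ∫ x in (z - δ / 2)..(z + δ / 2), ((g x - g' z * x) - (g z - g' z * z)) := by
    rw [intervalIntegral.integral_sub, intervalIntegral.integral_sub,
      intervalIntegral.integral_const_mul, integral_id, intervalIntegral.integral_const,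
      smul_eq_mul]
    · ring
    · exact hcont.intervalIntegrable _ _
    · exact Continuous.intervalIntegrable (by fun_prop) _ _
    · exact Continuous.intervalIntegrable (by fun_prop) _ _
    · exact intervalIntegrable_const
  rw [e, ← Real.norm_eq_abs]
  refine (intervalIntegral.norm_integral_le_of_norm_le_const (C := M * δ * δ) fun x hx => ?_).trans
    (le_of_eq ?_)
  · rw [Set.uIoc_of_le hle] at hx
    exact h2 x (Set.Ioc_subset_Icc_self hx)
  · rw [show z + δ / 2 - (z - δ / 2) = δ by ring, abs_of_pos hδ]
    ring

lemma one_add_sq_mul_midpoint_edgeworthDensity_le {a A δ : ℝ} (ha : |a| ≤ A) (hδ : 0 < δ) (z : ℝ) :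
    (1 + z ^ 2) *
      |(∫ x in Set.Ioc (z - δ / 2) (z + δ / 2), edgeworthDensity a x) - δ * edgeworthDensity a z| ≤
      (2 + δ ^ 2 / 2) * ((1 + 26 * A) * 768) * δ ^ 3 := by
  have hz : 0 < 1 + z ^ 2 := by positivity
  have h := abs_integral_sub_midpoint_le (M := (2 + δ ^ 2 / 2) * ((1 + 26 * A) * 768) / (1 + z ^ 2))
    hδ (hasDerivAt_edgeworthDensity a) (hasDerivAt_deriv_edgeworthDensity a) (z := z)
    fun x hx => by
      have h1 := one_add_sq_mul_abs_deriv_deriv_edgeworthDensity_le ha x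
      have h2 := one_add_sq_le_of_mem_cell hx
      rw [le_div_iff₀ hz]
      calc _ ≤ |gaussianPDFReal 0 1 x * (x ^ 2 - 1 + a * (x ^ 5 - 10 * x ^ 3 + 15 * x))| *
            ((2 + δ ^ 2 / 2) * (1 + x ^ 2)) := by gcongr
        _ = (2 + δ ^ 2 / 2) * ((1 + x ^ 2) *
            |gaussianPDFReal 0 1 x * (x ^ 2 - 1 + a * (x ^ 5 - 10 * x ^ 3 + 15 * x))|) := by ring
        _ ≤ _ := by gcongr
  rw [div_mul_eq_mul_div, le_div_iff₀ hz] at h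
  linarith

end density

section summation

lemma hasSum_integral_cell {F : ℝ → ℝ} (hF : Integrable F) {δ : ℝ} (hδ : 0 < δ) (b : ℝ) :
    HasSum (fun k : ℤ => ∫ x in Set.Ioc (δ * (k - b) - δ / 2) (δ * (k - b) + δ / 2), F x)
      (∫ x, F x) := by
  have e : ∀ k : ℤ, Set.Ioc (δ * (k - b) - δ / 2) (δ * (k - b) + δ / 2) =
      Set.Ioc ((-δ * b - δ / 2) + k • δ) ((-δ * b - δ / 2) + (k + 1) • δ) := by
    intro k
    simp only [zsmul_eq_mul]
    push_cast
    congr 1 <;> ring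
  have h := hasSum_integral_iUnion (μ := volume) (f := F)
    (s := fun k : ℤ => Set.Ioc ((-δ * b - δ / 2) + k • δ) ((-δ * b - δ / 2) + (k + 1) • δ))
    (fun k => measurableSet_Ioc) (Set.pairwise_disjoint_Ioc_add_zsmul _ _) hF.integrableOn
  rw [iUnion_Ioc_add_zsmul hδ, setIntegral_univ] at h
  simpa only [e] using h

lemma hasSum_integral_fiber {Ω : Type*} [MeasurableSpace Ω] {P : Measure Ω} {S : Ω → ℤ}
    (hS : Measurable S) {f : Ω → ℝ} (hf : Integrable f P) :
    HasSum (fun k : ℤ => ∫ ω in {ω | S ω = k}, f ω ∂P) (∫ ω, f ω ∂P) := by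
  have hU : ⋃ k : ℤ, {ω | S ω = k} = Set.univ := by ext; simp
  have h := hasSum_integral_iUnion (μ := P) (f := f) (s := fun k : ℤ => {ω | S ω = k})
    (fun k => hS (measurableSet_singleton k))
    (fun i j hij => Set.disjoint_left.2 fun ω hi hj => hij (hi.symm.trans hj)) hf.integrableOn
  rwa [hU, setIntegral_univ] at h

variable {h : ℝ → ℝ}

lemma integrable_mul_edgeworthDensity (hm : Measurable h) (hb : ∀ x, |h x| ≤ 1) (a : ℝ) :
    Integrable fun x => h x * edgeworthDensity a x :=
  (integrable_edgeworthDensity a).bdd_mul (c := 1) hm.aestronglyMeasurable (.of_forall hb)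

lemma integral_add_integral_hermite (hm : Measurable h) (hb : ∀ x, |h x| ≤ 1) (a : ℝ) :
    (∫ z, h z ∂(gaussianReal 0 1)) + a * ∫ z, (z ^ 3 - 3 * z) * h z ∂(gaussianReal 0 1) =
      ∫ x, h x * edgeworthDensity a x := by
  rw [integral_gaussianReal_eq_integral_smul one_ne_zero,
    integral_gaussianReal_eq_integral_smul one_ne_zero, ← integral_const_mul, ← integral_add]
  · refine integral_congr_ae (.of_forall fun x => ?_)
    simp only [smul_eq_mul, edgeworthDensity]
    ring
  · refine ((integrable_gaussianPDFReal 0 1).bdd_mul (c := 1) hm.aestronglyMeasurable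
      (.of_forall hb)).congr (.of_forall fun x => ?_)
    simp only [smul_eq_mul]
    ring
  · refine ((integrable_gaussianPDFReal_mul_hermite.bdd_mul (c := 1) hm.aestronglyMeasurable
      (.of_forall hb)).const_mul a).congr (.of_forall fun x => ?_)
    simp only [smul_eq_mul]
    ring

/-- Comparison of the atom at `z` with the signed density on the cell around `z`, for a test
function that is constant on the cell whenever the atom is charged. -/
lemma abs_atom_sub_integral_cell_le (hb : ∀ x, |h x| ≤ 1) {p z δ a : ℝ}
    (hconst : p ≠ 0 → ∀ x ∈ Set.Ioo (z - δ / 2) (z + δ / 2), h x = h z) :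
    |p * h z - ∫ x in Set.Ioc (z - δ / 2) (z + δ / 2), h x * edgeworthDensity a x| ≤
      |p - ∫ x in Set.Ioc (z - δ / 2) (z + δ / 2), edgeworthDensity a x| +
      2 * a ^ 2 * ∫ x in Set.Ioc (z - δ / 2) (z + δ / 2),
        gaussianPDFReal 0 1 x * (x ^ 3 - 3 * x) ^ 2 := by
  have hpos : 0 ≤ ∫ x in Set.Ioc (z - δ / 2) (z + δ / 2),
      gaussianPDFReal 0 1 x * (x ^ 3 - 3 * x) ^ 2 :=
    integral_nonneg fun x => mul_nonneg (gaussianPDFReal_nonneg 0 1 x) (sq_nonneg _)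
  have ig := (integrable_edgeworthDensity a).integrableOn (s := Set.Ioc (z - δ / 2) (z + δ / 2))
  have iq := integrable_gaussianPDFReal_mul_hermite_sq.integrableOn
    (s := Set.Ioc (z - δ / 2) (z + δ / 2))
  by_cases hp : p = 0
  · rw [hp, zero_mul, zero_sub, zero_sub, abs_neg, abs_neg]
    have h1 : |∫ x in Set.Ioc (z - δ / 2) (z + δ / 2), h x * edgeworthDensity a x| ≤
        ∫ x in Set.Ioc (z - δ / 2) (z + δ / 2), (edgeworthDensity a x +
          2 * a ^ 2 * (gaussianPDFReal 0 1 x * (x ^ 3 - 3 * x) ^ 2)) := by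
      rw [← Real.norm_eq_abs]
      refine norm_integral_le_of_norm_le (ig.add (iq.const_mul _)) (.of_forall fun x => ?_)
      rw [Real.norm_eq_abs, abs_mul]
      exact (mul_le_of_le_one_left (abs_nonneg _) (hb x)).trans (abs_edgeworthDensity_le a x)
    rw [integral_add ig (iq.const_mul _), integral_const_mul] at h1
    exact h1.trans (by gcongr; exact le_abs_self _)
  · have e : ∫ x in Set.Ioc (z - δ / 2) (z + δ / 2), h x * edgeworthDensity a x =
        h z * ∫ x in Set.Ioc (z - δ / 2) (z + δ / 2), edgeworthDensity a x := by
      rw [integral_Ioc_eq_integral_Ioo, integral_Ioc_eq_integral_Ioo, ← integral_const_mul]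
      exact setIntegral_congr_fun measurableSet_Ioo fun x hx => by simp only [hconst hp x hx]
    rw [e, mul_comm p, ← mul_sub, abs_mul]
    refine (mul_le_of_le_one_left (abs_nonneg _) (hb z)).trans ?_
    have : 0 ≤ 2 * a ^ 2 * ∫ x in Set.Ioc (z - δ / 2) (z + δ / 2),
      gaussianPDFReal 0 1 x * (x ^ 3 - 3 * x) ^ 2 := by positivity
    linarith

lemma div_one_add_sq_le_integral_cell {δ : ℝ} (hδ : 0 < δ) (z : ℝ) :
    δ / (1 + z ^ 2) ≤
      (2 + δ ^ 2 / 2) * ∫ x in Set.Ioc (z - δ / 2) (z + δ / 2), (1 + x ^ 2)⁻¹ := by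
  have h1 : ∀ x ∈ Set.Ioc (z - δ / 2) (z + δ / 2),
      (1 + z ^ 2)⁻¹ ≤ (2 + δ ^ 2 / 2) * (1 + x ^ 2)⁻¹ := by
    intro x hx
    have h2 : |z - x| ≤ δ / 2 := by rw [abs_le]; constructor <;> linarith [hx.1, hx.2]
    have h3 := one_add_sq_le_of_mem_cell h2
    rw [← div_eq_mul_inv, inv_eq_one_div, div_le_div_iff₀ (by positivity) (by positivity)]
    linarith
  rw [← integral_const_mul]
  refine le_trans (le_of_eq ?_) (setIntegral_mono_on (integrable_const _)
    (integrable_inv_one_add_sq.integrableOn.const_mul _) measurableSet_Ioc h1)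
  rw [setIntegral_const, Real.volume_real_Ioc_of_le (by linarith), smul_eq_mul]
  ring

/-- If the atoms are close to the cell integrals of the signed Edgeworth density, then so are the
expectations of test functions compatible with the lattice. -/
lemma abs_integral_sub_integral_edgeworthDensity_le {Ω : Type*} [MeasurableSpace Ω]
    {P : Measure Ω} [IsProbabilityMeasure P] {S : Ω → ℤ} (hS : Measurable S) (hm : Measurable h)
    (hb : ∀ x, |h x| ≤ 1) {δ a b C : ℝ} (hδ : 0 < δ)
    (hconst : ∀ k : ℤ, P.real {ω | S ω = k} ≠ 0 →
      ∀ x ∈ Set.Ioo (δ * (k - b) - δ / 2) (δ * (k - b) + δ / 2), h x = h (δ * (k - b)))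
    (hloc : ∀ k : ℤ, (1 + (δ * (k - b)) ^ 2) * |P.real {ω | S ω = k} -
      ∫ x in Set.Ioc (δ * (k - b) - δ / 2) (δ * (k - b) + δ / 2), edgeworthDensity a x| ≤
        C * δ ^ 3) :
    |(∫ ω, h (δ * (S ω - b)) ∂P) - ∫ x, h x * edgeworthDensity a x| ≤
      C * δ ^ 2 * (2 + δ ^ 2 / 2) * Real.pi +
      2 * a ^ 2 * ∫ x, gaussianPDFReal 0 1 x * (x ^ 3 - 3 * x) ^ 2 := by
  have hC : 0 ≤ C := by
    have h1 := hloc 0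
    have h2 : 0 ≤ C * δ ^ 3 := le_trans (by positivity) h1
    exact nonneg_of_mul_nonneg_left h2 (by positivity)
  have hcast : Measurable fun ω => ((S ω : ℤ) : ℝ) := (measurable_of_countable _).comp hS
  have hi : Integrable (fun ω => h (δ * (S ω - b))) P :=
    Integrable.of_bound (hm.comp (by fun_prop)).aestronglyMeasurable 1 (.of_forall fun ω => hb _)
  have s1 := hasSum_integral_fiber hS hi
  have s2 := hasSum_integral_cell (integrable_mul_edgeworthDensity hm hb a) hδ b
  have s3 := ((hasSum_integral_cell integrable_inv_one_add_sq hδ b).mul_left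
    (C * δ ^ 2 * (2 + δ ^ 2 / 2))).add ((hasSum_integral_cell
      integrable_gaussianPDFReal_mul_hermite_sq hδ b).mul_left (2 * a ^ 2))
  rw [integral_univ_inv_one_add_sq] at s3
  have s4 := s1.sub s2
  rw [← s4.tsum_eq, ← Real.norm_eq_abs]
  refine tsum_of_norm_bounded s3 fun k => ?_
  have hk : MeasurableSet {ω | S ω = k} := hS (measurableSet_singleton k)
  have e : ∫ ω in {ω | S ω = k}, h (δ * (S ω - b)) ∂P =
      P.real {ω | S ω = k} * h (δ * (k - b)) := by
    rw [setIntegral_congr_fun (g := fun _ => h (δ * (k - b))) hk fun ω hω => ?_, setIntegral_const,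
      smul_eq_mul]
    have : S ω = k := hω
    simp only [this]
  rw [e, Real.norm_eq_abs]
  refine (abs_atom_sub_integral_cell_le hb (hconst k)).trans ?_
  gcongr
  set z := δ * (k - b)
  have hz : 0 < 1 + z ^ 2 := by positivity
  have h1 := hloc k
  rw [mul_comm, ← le_div_iff₀ hz] at h1
  calc _ ≤ C * δ ^ 3 / (1 + z ^ 2) := h1
    _ = C * δ ^ 2 * (δ / (1 + z ^ 2)) := by ring
    _ ≤ C * δ ^ 2 * ((2 + δ ^ 2 / 2) *
        ∫ x in Set.Ioc (z - δ / 2) (z + δ / 2), (1 + x ^ 2)⁻¹) := by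
      gcongr
      exact div_one_add_sq_le_integral_cell hδ z
    _ = _ := by ring

end summation

section assembly

variable {μ : Measure ℤ} [IsProbabilityMeasure μ] {μ₀ σ γ : ℝ}

lemma integrable_standardized_pow_four (h4 : Integrable (fun k : ℤ => (k : ℝ) ^ 4) μ) :
    Integrable (fun k : ℤ => (((k : ℝ) - μ₀) / σ) ^ 4) μ := by
  have hY : Measurable fun k : ℤ => (k : ℝ) := measurable_of_countable _
  have i := fun j (hj : j ≤ 4) => integrable_pow_of_pow_four hY h4 hj
  have h := ((((h4.sub ((i 3 (by norm_num)).const_mul (4 * μ₀))).add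
    ((i 2 (by norm_num)).const_mul (6 * μ₀ ^ 2))).sub
    ((i 1 (by norm_num)).const_mul (4 * μ₀ ^ 3))).add (integrable_const (μ₀ ^ 4))).div_const (σ ^ 4)
  refine h.congr (.of_forall fun k => ?_)
  simp only [Pi.add_apply, Pi.sub_apply]
  rw [div_pow]
  ring

lemma lattice_sum_eq {n : ℕ} {δ : ℝ} (hδ : δ = 1 / (σ * Real.sqrt n)) (ω : Fin n → ℤ) :
    (∑ i, ((ω i : ℝ) - μ₀)) / (σ * Real.sqrt n) = δ * ((∑ i, ω i : ℤ) - n * μ₀) := by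
  rw [hδ, Finset.sum_sub_distrib]
  push_cast
  simp
  ring

lemma exists_edgeworth_bound_of_two_le (hσ : 0 < σ)
    (h4 : Integrable (fun k : ℤ => (((k : ℝ) - μ₀) / σ) ^ 4) μ)
    (hY1 : ∫ k : ℤ, ((k : ℝ) - μ₀) / σ ∂μ = 0) (hY2 : ∫ k : ℤ, (((k : ℝ) - μ₀) / σ) ^ 2 ∂μ = 1)
    (hY3 : ∫ k : ℤ, (((k : ℝ) - μ₀) / σ) ^ 3 ∂μ = γ)
    (hlt : ∀ s : ℝ, s ≠ 0 → |s| ≤ Real.pi * σ →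
      ‖momentChar μ (fun k : ℤ => ((k : ℝ) - μ₀) / σ) 0 s‖ < 1) :
    ∃ C : ℝ, 0 ≤ C ∧ ∀ n : ℕ, 2 ≤ n → ∀ h : ℝ → ℝ, Measurable h → (∀ x, |h x| ≤ 1) →
      (∀ z : ℝ,
        (Measure.pi fun _ : Fin n => μ)
            {ω | (∑ i, ((ω i : ℝ) - μ₀)) / (σ * Real.sqrt n) = z} ≠ 0 →
        ∀ x ∈ Set.Ioo (z - 1 / (2 * σ * Real.sqrt n)) (z + 1 / (2 * σ * Real.sqrt n)),
          h x = h z) →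
      |(∫ ω, h ((∑ i, ((ω i : ℝ) - μ₀)) / (σ * Real.sqrt n)) ∂(Measure.pi fun _ : Fin n => μ)) -
          ∫ x, h x * edgeworthDensity (γ / (6 * Real.sqrt n)) x| ≤ C / n := by
  obtain ⟨C, hC, hloc⟩ := exists_local_bound hσ h4 hY1 hY2 hY3 hlt
  set K := ∫ x, gaussianPDFReal 0 1 x * (x ^ 3 - 3 * x) ^ 2 with hK
  have hK0 : 0 ≤ K :=
    integral_nonneg fun x => mul_nonneg (gaussianPDFReal_nonneg 0 1 x) (sq_nonneg _)
  set D := (1 + 26 * (|γ| / 6)) * 768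
  set q := 2 + (1 / σ ^ 2) / 2
  refine ⟨(C + q * D) * q * Real.pi / σ ^ 2 + γ ^ 2 / 18 * K, by positivity,
    fun n hn h hm hb hconst => ?_⟩
  have hn1 : (1 : ℝ) ≤ n := by exact_mod_cast (by omega : 1 ≤ n)
  have hn0 : (0 : ℝ) < n := by linarith
  have hsn := Real.sqrt_pos.2 hn0
  obtain ⟨δ, hδ⟩ : ∃ δ, δ = 1 / (σ * Real.sqrt n) := ⟨_, rfl⟩
  have hδ0 : 0 < δ := by rw [hδ]; positivity
  have hδ2 : δ ^ 2 = 1 / σ ^ 2 / n := by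
    rw [hδ, div_pow, mul_pow, Real.sq_sqrt hn0.le]; field_simp
  have hδle : δ ^ 2 ≤ 1 / σ ^ 2 := by
    rw [hδ2]; exact div_le_self (by positivity) hn1
  have hq : 2 + δ ^ 2 / 2 ≤ q := by simp only [q]; gcongr
  set a := γ / (6 * Real.sqrt n) with ha
  have ha2 : a ^ 2 = γ ^ 2 / 36 / n := by
    rw [ha, div_pow, mul_pow, Real.sq_sqrt hn0.le]; field_simp; norm_num
  have haA : |a| ≤ |γ| / 6 := by
    rw [ha, abs_div, abs_of_pos (by positivity : 0 < 6 * Real.sqrt n)]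
    gcongr
    nlinarith [Real.one_le_sqrt.2 hn1]
  have hS : Measurable fun ω : Fin n → ℤ => ∑ i, ω i :=
    Finset.measurable_sum _ fun i _ => measurable_pi_apply i
  have hhalf : 1 / (2 * σ * Real.sqrt n) = δ / 2 := by rw [hδ]; field_simp
  simp_rw [lattice_sum_eq hδ, hhalf] at hconst ⊢
  refine (abs_integral_sub_integral_edgeworthDensity_le (C := C + q * D) hS hm hb hδ0
    (fun k hk x hx => hconst _ (fun h0 => hk ?_) x hx) fun k => ?_).trans ?_
  · rw [measureReal_def, measure_mono_null (fun ω hω => ?_) h0, ENNReal.toReal_zero]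
    have h1 : ∑ i, ω i = k := hω
    change δ * _ = _
    rw [h1]
  · have h1 := hloc n hn δ hδ k
    have h2 := one_add_sq_mul_midpoint_edgeworthDensity_le haA hδ0 (δ * (k - n * μ₀))
    change _ ≤ (2 + δ ^ 2 / 2) * D * δ ^ 3 at h2
    have h3 : (2 + δ ^ 2 / 2) * D * δ ^ 3 ≤ q * D * δ ^ 3 := by gcongr
    set z := δ * (k - n * μ₀)
    have h4 := abs_sub_le ((Measure.pi fun _ : Fin n => μ).real {ω | ∑ i, ω i = k})
      (δ * edgeworthDensity a z) (∫ x in Set.Ioc (z - δ / 2) (z + δ / 2), edgeworthDensity a x)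
    rw [abs_sub_comm (δ * _)] at h4
    have h5 := mul_le_mul_of_nonneg_left h4 (by positivity : 0 ≤ 1 + z ^ 2)
    rw [mul_add] at h5
    linarith
  · rw [← hK, ha2]
    calc _ ≤ (C + q * D) * δ ^ 2 * q * Real.pi + 2 * (γ ^ 2 / 36 / n) * K := by gcongr
      _ = _ := by rw [hδ2]; field_simp; ring

end assembly

end Edgeworth

/-- **Discrete two-term Edgeworth expansion.**
Let the law `μ` (on `ℤ`) of the i.i.d. summands have mean `μ₀`, variance `σ² > 0`, third
central moment `σ³γ`, finite fourth moment, and support whose differences from a support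
point `s₀` have greatest common divisor `1`. Then for test functions `h` bounded by `1`
that are constant on the interval `(z - 1/(2σ√n), z + 1/(2σ√n))` around each point `z` of
the support of `W = (∑ (Xᵢ - μ₀))/(σ√n)`, the two-term Edgeworth expansion holds with
error rate `C / n`, where `C` does not depend on `n`. -/
theorem discrete_two_term_edgeworth
    (μ : Measure ℤ) (hprob : IsProbabilityMeasure μ) (μ₀ σ γ : ℝ) (hσ : 0 < σ)
    (hmean : ∫ k, (k : ℝ) ∂μ = μ₀)
    (hvar : ∫ k, ((k : ℝ) - μ₀) ^ 2 ∂μ = σ ^ 2)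
    (hthird : ∫ k, ((k : ℝ) - μ₀) ^ 3 ∂μ = σ ^ 3 * γ)
    (hfourth : Integrable (fun k : ℤ => (k : ℝ) ^ 4) μ)
    (s₀ : ℤ) (hs₀ : μ {s₀} ≠ 0)
    (hgcd : ∀ d : ℕ, (∀ s : ℤ, μ {s} ≠ 0 → (d : ℤ) ∣ (s - s₀)) → d = 1) :
    ∃ C : ℝ, ∀ n : ℕ, 1 ≤ n →
      ∀ h : ℝ → ℝ, Measurable h → (∀ x, |h x| ≤ 1) →
      (∀ z : ℝ,
        (Measure.pi fun _ : Fin n => μ)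
            {ω | (∑ i, ((ω i : ℝ) - μ₀)) / (σ * Real.sqrt n) = z} ≠ 0 →
        ∀ x ∈ Set.Ioo (z - 1 / (2 * σ * Real.sqrt n)) (z + 1 / (2 * σ * Real.sqrt n)),
          h x = h z) →
      |(∫ ω, h ((∑ i, ((ω i : ℝ) - μ₀)) / (σ * Real.sqrt n))
            ∂(Measure.pi fun _ : Fin n => μ)) -
          (∫ z, h z ∂(gaussianReal 0 1)) -
          γ / (6 * Real.sqrt n) * ∫ z, (z ^ 3 - 3 * z) * h z ∂(gaussianReal 0 1)|
        ≤ C / n := by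
  have hs2 : σ ^ 2 ≠ 0 := by positivity
  have hs3 : σ ^ 3 ≠ 0 := by positivity
  have h4 := Edgeworth.integrable_standardized_pow_four (μ₀ := μ₀) (σ := σ) hfourth
  have i1 : Integrable (fun k : ℤ => (k : ℝ)) μ := by
    simpa using Edgeworth.integrable_pow_of_pow_four (μ := μ) (Y := fun k : ℤ => (k : ℝ))
      (measurable_of_countable _) hfourth (show 1 ≤ 4 by norm_num)
  have hY1 : ∫ k : ℤ, ((k : ℝ) - μ₀) / σ ∂μ = 0 := by
    rw [integral_div, integral_sub i1 (integrable_const _), hmean]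
    simp
  have hY2 : ∫ k : ℤ, (((k : ℝ) - μ₀) / σ) ^ 2 ∂μ = 1 := by
    simp_rw [div_pow]
    rw [integral_div, hvar, div_self hs2]
  have hY3 : ∫ k : ℤ, (((k : ℝ) - μ₀) / σ) ^ 3 ∂μ = γ := by
    simp_rw [div_pow]
    rw [integral_div, hthird, mul_div_cancel_left₀ _ hs3]
  obtain ⟨C, hC, hmain⟩ := Edgeworth.exists_edgeworth_bound_of_two_le hσ h4 hY1 hY2 hY3
    fun s hs hle => Edgeworth.norm_momentChar_lt_one hσ hs₀ hgcd hs hle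
  set B := ∫ x, |Edgeworth.edgeworthDensity (γ / 6) x| with hB
  have hB0 : 0 ≤ B := integral_nonneg fun x => abs_nonneg _
  refine ⟨C + (1 + B), fun n hn h hm hb hconst => ?_⟩
  rw [sub_sub, Edgeworth.integral_add_integral_hermite hm hb]
  rcases hn.eq_or_lt with rfl | hn
  · have h1 : |∫ ω, h ((∑ i, ((ω i : ℝ) - μ₀)) / (σ * Real.sqrt (1 : ℕ)))
        ∂(Measure.pi fun _ : Fin 1 => μ)| ≤ 1 := by
      rw [← Real.norm_eq_abs]
      refine (norm_integral_le_of_norm_le_const (.of_forall fun ω => hb _)).trans ?_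
      simp
    have h2 : |∫ x, h x * Edgeworth.edgeworthDensity (γ / (6 * Real.sqrt (1 : ℕ))) x| ≤ B := by
      rw [Nat.cast_one, Real.sqrt_one, mul_one, ← Real.norm_eq_abs]
      refine norm_integral_le_of_norm_le (Edgeworth.integrable_edgeworthDensity _).abs
        (.of_forall fun x => ?_)
      rw [norm_mul]
      exact mul_le_of_le_one_left (norm_nonneg _) (hb x)
    refine (abs_sub _ _).trans ((add_le_add h1 h2).trans ?_)
    simp [hC]
  · refine (hmain n hn h hm hb hconst).trans ?_
    gcongr
    linarith
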